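/- arXiv:2410.19387 — 2 statements merged into one kernel-verified Lean document; each statement's English description precedes it below -/
import Mathlib

section
/- Let −A be the generator of a C₀-semigroup (e^{-tA})_{t≥0} on a complex Hilbert space H and let β ∈ (0,1] be fixed. Then the following are equivalent: (i) (e^{-tA})_{t≥0} is in the Crandall–Pazy class with parameter β; (ii) the set σ(A) ∩ iℝ is bounded and there exist constants M, R > 0 such that for every real η with |η| ≥ R the operator iη + A has a bounded inverse and ‖(iη + A)^{-1}‖ ≤ M |η|^{-β}. -/
open Filter Topology Asymptotics

noncomputable section

variable {H : Type*} [NormedAddCommGroup H] [InnerProductSpace ℂ H]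

/-- `T` is a strongly continuous one-parameter semigroup on `H` (written `T t = e^{-tA}`). -/
structure IsC0Semigroup (T : ℝ → H →L[ℂ] H) : Prop where
  map_zero : T 0 = 1
  map_add : ∀ s t : ℝ, 0 ≤ s → 0 ≤ t → T (s + t) = T s ∘L T t
  strong_continuity : ∀ x : H, ContinuousOn (fun t : ℝ => T t x) (Set.Ici 0)

/-- `-A` is the generator of the semigroup `T`, i.e. `-A x = lim_{h→0+} h⁻¹ (T h x - x)`
with domain the set of `x` for which this limit exists. -/
def IsGenerator (T : ℝ → H →L[ℂ] H) (A : H →ₗ.[ℂ] H) : Prop :=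
  (∀ x : H, x ∈ A.domain ↔
      ∃ y : H, Tendsto (fun h : ℝ => (h : ℂ)⁻¹ • (T h x - x)) (𝓝[>] 0) (𝓝 y)) ∧
  ∀ x : A.domain,
    Tendsto (fun h : ℝ => (h : ℂ)⁻¹ • (T h (x : H) - (x : H))) (𝓝[>] 0) (𝓝 (-(A x)))

/-- `R` is a (two-sided) bounded inverse of the operator `lam + A`.  In particular
`lam + A` is injective and surjective onto `H`, so `R = (lam + A)⁻¹`. -/
def IsResolventAt (A : H →ₗ.[ℂ] H) (lam : ℂ) (R : H →L[ℂ] H) : Prop :=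
  (∀ x : H, ∃ hx : R x ∈ A.domain, lam • R x + A ⟨R x, hx⟩ = x) ∧
  ∀ x : A.domain, R (lam • (x : H) + A x) = (x : H)

/-- The semigroup `T = (e^{-tA})_{t ≥ 0}` is in the Crandall–Pazy class with parameter `β`:
`e^{-tA} H ⊆ D(A)` for `t > 0`, `A e^{-tA}` extends to a bounded operator `B t`, and
`‖A e^{-tA}‖ = O(t^{-1/β})` as `t → 0+`. -/
def InCrandallPazy (T : ℝ → H →L[ℂ] H) (A : H →ₗ.[ℂ] H) (β : ℝ) : Prop :=
  ∃ B : ℝ → H →L[ℂ] H,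
    (∀ t : ℝ, 0 < t → ∀ x : H, ∃ hx : T t x ∈ A.domain, B t x = A ⟨T t x, hx⟩) ∧
    ∃ M t₀ : ℝ, 0 < M ∧ 0 < t₀ ∧ ∀ t : ℝ, 0 < t → t ≤ t₀ → ‖B t‖ ≤ M * t ^ (-(1 / β))

open MeasureTheory FourierTransform in
/-- On `L¹ ∩ L²` the `L²` Fourier transform is given by the Fourier integral. -/
theorem fourier_toLp_two_ae_eq [CompleteSpace H] {f : ℝ → H} (hf1 : Integrable f)
    (hf2 : MemLp f 2) :
    ((𝓕 (hf2.toLp f) : Lp (α := ℝ) H 2) : ℝ → H) =ᵐ[volume] 𝓕 f := by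
  have hcont : Continuous (𝓕 f) :=
    VectorFourier.fourierIntegral_continuous Real.continuous_fourierChar
      (by exact continuous_inner) hf1
  refine ae_eq_of_integral_contDiff_smul_eq ?_ hcont.locallyIntegrable ?_
  · exact (Lp.memLp _).locallyIntegrable (by norm_num)
  intro g hg hgc
  let G : ℝ → ℂ := fun x => (g x : ℂ)
  have hG : ContDiff ℝ (⊤ : ℕ∞) G := Complex.ofRealCLM.contDiff.comp hg
  have hGc : HasCompactSupport G := hgc.comp_left (g := fun r : ℝ => (r : ℂ)) (by simp)
  let φ : SchwartzMap ℝ ℂ := hGc.toSchwartzMap hG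
  have hφ : ∀ x, φ x = (g x : ℂ) := fun x => rfl
  have h1 := congrArg (fun u => u φ) (Lp.fourier_toTemperedDistribution_eq (hf2.toLp f))
  simp only [TemperedDistribution.fourier_apply, Lp.toTemperedDistribution_apply] at h1
  have h2 : ∫ x, (𝓕 φ) x • (hf2.toLp f) x = ∫ x, (𝓕 φ) x • f x := by
    apply integral_congr_ae
    filter_upwards [hf2.coeFn_toLp] with x hx
    rw [hx]
  have h3 : ∫ x, (𝓕 φ) x • f x = ∫ x, φ x • (𝓕 f) x := by
    have := VectorFourier.integral_fourierIntegral_smul_eq_flip (e := Real.fourierChar)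
      (μ := (volume : Measure ℝ)) (ν := (volume : Measure ℝ)) (L := innerₗ ℝ)
      (f := φ) (g := f) Real.continuous_fourierChar
      (by exact continuous_inner) φ.integrable hf1
    rw [flip_innerₗ] at this
    rw [SchwartzMap.fourier_coe]
    exact this
  rw [h2, h3] at h1
  simp only [hφ, Complex.coe_smul] at h1
  exact h1.symm

open MeasureTheory FourierTransform in
/-- Plancherel's theorem on `L¹ ∩ L²`. -/
theorem eLpNorm_two_fourier_eq [CompleteSpace H] {f : ℝ → H} (hf1 : Integrable f)
    (hf2 : MemLp f 2) : eLpNorm (𝓕 f) 2 volume = eLpNorm f 2 volume := by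
  have h := Lp.norm_fourier_eq (hf2.toLp f)
  rw [Lp.norm_def, Lp.norm_def, ENNReal.toReal_eq_toReal_iff' (Lp.eLpNorm_ne_top _)
    (Lp.eLpNorm_ne_top _), eLpNorm_congr_ae hf2.coeFn_toLp,
    eLpNorm_congr_ae (fourier_toLp_two_ae_eq hf1 hf2)] at h
  exact h

/-- `(x, y)` lies in the graph of the generator of `T`: the orbit of `x` has right derivative `y`
at `0`. -/
def GeneratorGraph (T : ℝ → H →L[ℂ] H) (x y : H) : Prop :=
  Tendsto (fun h : ℝ => (h : ℂ)⁻¹ • (T h x - x)) (𝓝[>] 0) (𝓝 y)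

theorem IsGenerator.graph_iff {T : ℝ → H →L[ℂ] H} {A : H →ₗ.[ℂ] H} (hgen : IsGenerator T A)
    {x y : H} : GeneratorGraph T x (-y) ↔ ∃ hx : x ∈ A.domain, A ⟨x, hx⟩ = y := by
  constructor
  · intro h
    have hx := (hgen.1 x).2 ⟨_, h⟩
    exact ⟨hx, neg_injective (tendsto_nhds_unique (hgen.2 ⟨x, hx⟩) h)⟩
  · rintro ⟨hx, rfl⟩
    exact hgen.2 ⟨x, hx⟩

theorem GeneratorGraph.rescale {T : ℝ → H →L[ℂ] H} {x y : H} (h : GeneratorGraph T x y) (c : ℂ) :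
    GeneratorGraph (fun t : ℝ => Complex.exp (-(c * t)) • T t) x (y - c • x) := by
  have hE : HasDerivAt (fun t : ℝ => Complex.exp (-(c * t))) (-c) 0 := by
    have h1 : HasDerivAt (fun z : ℂ => Complex.exp (-(c * z)))
        (Complex.exp (-(c * ((0 : ℝ) : ℂ))) * (-(c * 1))) ((0 : ℝ) : ℂ) :=
      (((hasDerivAt_id _).const_mul c).neg).cexp
    simpa using h1.comp_ofReal
  have hE1 : Tendsto (fun t : ℝ => (t : ℂ)⁻¹ * (Complex.exp (-(c * t)) - 1)) (𝓝[>] 0)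
      (𝓝 (-c)) := by
    have h2 := (hasDerivWithinAt_iff_tendsto_slope' (s := Set.Ioi (0 : ℝ)) (by simp)).1
      hE.hasDerivWithinAt
    refine h2.congr fun t => ?_
    simp [slope_def_module, Complex.real_smul]
  have hE0 : Tendsto (fun t : ℝ => Complex.exp (-(c * t))) (𝓝[>] 0) (𝓝 1) := by
    have : Continuous (fun t : ℝ => Complex.exp (-(c * t))) := by fun_prop
    simpa using (this.tendsto 0).mono_left nhdsWithin_le_nhds
  have h3 := (hE0.smul h).add (hE1.smul_const x)
  rw [one_smul, neg_smul, ← sub_eq_add_neg] at h3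
  refine h3.congr fun t => ?_
  simp only [smul_apply, smul_sub, mul_sub, sub_smul, mul_one, smul_smul,
    mul_comm]
  abel

theorem GeneratorGraph.of_rescale {T : ℝ → H →L[ℂ] H} {x y : H} {c : ℂ}
    (h : GeneratorGraph (fun t : ℝ => Complex.exp (-(c * t)) • T t) x y) :
    GeneratorGraph T x (y + c • x) := by
  have h1 := h.rescale (-c)
  simpa [smul_smul, ← Complex.exp_add] using h1

namespace IsC0Semigroup

variable {T : ℝ → H →L[ℂ] H}

theorem continuous_orbit (hT : IsC0Semigroup T) (x : H) :
    Continuous fun s : ℝ => T (max s 0) x :=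
  (hT.strong_continuity x).comp_continuous (by fun_prop) fun s => Set.mem_Ici.2 (le_max_right s 0)

theorem intervalIntegral_orbit (x : H) {t : ℝ} (ht : 0 ≤ t) :
    ∫ s in (0 : ℝ)..t, T (max s 0) x = ∫ s in (0 : ℝ)..t, T s x := by
  apply intervalIntegral.integral_congr
  intro s hs
  rw [Set.uIcc_of_le ht] at hs
  simp [max_eq_left hs.1]

theorem intervalIntegrable_orbit (hT : IsC0Semigroup T) (x : H) {t : ℝ} (ht : 0 ≤ t) :
    IntervalIntegrable (fun s => T s x) MeasureTheory.volume 0 t := by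
  apply ContinuousOn.intervalIntegrable
  rw [Set.uIcc_of_le ht]
  exact (hT.strong_continuity x).mono Set.Icc_subset_Ici_self

theorem exists_norm_le_Icc [CompleteSpace H] (hT : IsC0Semigroup T) :
    ∃ K : ℝ, 1 ≤ K ∧ ∀ t, 0 ≤ t → t ≤ 1 → ‖T t‖ ≤ K := by
  obtain ⟨C, hC⟩ := banach_steinhaus (g := fun t : Set.Icc (0 : ℝ) 1 => T t) (by
    intro x
    obtain ⟨C, hC⟩ := (isCompact_Icc (a := (0 : ℝ)) (b := 1)).exists_bound_of_continuousOn
      ((hT.strong_continuity x).mono Set.Icc_subset_Ici_self)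
    exact ⟨C, fun i => hC i i.2⟩)
  exact ⟨max 1 C, le_max_left _ _, fun t h0 h1 => (hC ⟨t, h0, h1⟩).trans (le_max_right _ _)⟩

theorem exists_norm_le_exp [CompleteSpace H] (hT : IsC0Semigroup T) :
    ∃ K ω : ℝ, 1 ≤ K ∧ 0 ≤ ω ∧ ∀ t, 0 ≤ t → ‖T t‖ ≤ K * Real.exp (ω * t) := by
  obtain ⟨K, hK1, hK⟩ := hT.exists_norm_le_Icc
  have hlog : 0 ≤ Real.log K := Real.log_nonneg hK1
  have hstep : ∀ n : ℕ, ∀ t : ℝ, 0 ≤ t → t ≤ n + 1 → ‖T t‖ ≤ K * Real.exp (Real.log K * t) := by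
    have hbase : ∀ t, 0 ≤ t → t ≤ 1 → ‖T t‖ ≤ K * Real.exp (Real.log K * t) := fun t h0 h1 =>
      (hK t h0 h1).trans (le_mul_of_one_le_right (by linarith) (Real.one_le_exp (by positivity)))
    intro n
    induction n with
    | zero => intro t h0 h1; exact hbase t h0 (by simpa using h1)
    | succ n ih =>
      intro t h0 h1
      rcases le_total t 1 with ht | ht
      · exact hbase t h0 ht
      push_cast at h1
      have hadd := hT.map_add 1 (t - 1) zero_le_one (by linarith)
      rw [add_sub_cancel] at hadd
      rw [hadd]
      calc ‖T 1 ∘L T (t - 1)‖ ≤ ‖T 1‖ * ‖T (t - 1)‖ := ContinuousLinearMap.opNorm_comp_le _ _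
        _ ≤ K * (K * Real.exp (Real.log K * (t - 1))) := by
            gcongr
            · exact hK 1 zero_le_one le_rfl
            · exact ih (t - 1) (by linarith) (by linarith)
        _ = K * Real.exp (Real.log K * t) := by
            rw [mul_sub, mul_one, Real.exp_sub, Real.exp_log (by linarith)]
            field_simp
  refine ⟨K, Real.log K, hK1, hlog, fun t ht => ?_⟩
  obtain ⟨n, hn⟩ := exists_nat_ge t
  exact hstep n t ht (by linarith)

/-- The rescaled semigroup `e^{-ct} T(t)` is again strongly continuous. -/
theorem rescale (hT : IsC0Semigroup T) (c : ℂ) :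
    IsC0Semigroup fun t : ℝ => Complex.exp (-(c * t)) • T t where
  map_zero := by simp [hT.map_zero]
  map_add s t hs ht := by
    ext x
    simp only [hT.map_add s t hs ht, smul_apply,
      ContinuousLinearMap.comp_apply, map_smul, smul_smul, ← Complex.exp_add]
    congr 2
    push_cast
    ring
  strong_continuity x := by
    simp only [smul_apply]
    exact ContinuousOn.smul (by fun_prop) (hT.strong_continuity x)

/-- The orbit integral `∫₀ᵗ T(s)x ds` lies in the domain of the generator. -/
theorem graph_integral [CompleteSpace H] (hT : IsC0Semigroup T) (x : H) {t : ℝ} (ht : 0 ≤ t) :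
    GeneratorGraph T (∫ s in (0 : ℝ)..t, T s x) (T t x - x) := by
  have hc := hT.continuous_orbit x
  set F : ℝ → H := fun u => ∫ s in (0 : ℝ)..u, T (max s 0) x with hF
  have hd : ∀ u, HasDerivAt F (T (max u 0) x) u := fun u =>
    (hc.integral_hasStrictDerivAt 0 u).hasDerivAt
  have hlim : ∀ u, Tendsto (fun h : ℝ => (h : ℂ)⁻¹ • (F (u + h) - F u)) (𝓝[>] 0)
      (𝓝 (T (max u 0) x)) := fun u => by
    refine ((hd u).tendsto_slope_zero_right).congr fun h => ?_
    rw [← Complex.ofReal_inv, Complex.coe_smul]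
  have h1 := (hlim t).sub (hlim 0)
  simp only [max_eq_left ht, max_self, hT.map_zero, one_apply_eq_self, zero_add] at h1
  refine h1.congr' ?_
  filter_upwards [self_mem_nhdsWithin] with h hh
  have hh' : (0 : ℝ) < h := hh
  have hF0 : F 0 = 0 := by simp [hF]
  rw [← smul_sub, hF0, sub_zero, ← intervalIntegral_orbit x ht]
  have key : T h (F t) = F (t + h) - F h := by
    rw [hF, ← ContinuousLinearMap.intervalIntegral_comp_comm _ (hc.intervalIntegrable _ _),
      intervalIntegral.integral_interval_sub_left (hc.intervalIntegrable _ _)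
      (hc.intervalIntegrable _ _)]
    have : ∫ s in h..t + h, T (max s 0) x = ∫ s in (0 : ℝ)..t, T (max (s + h) 0) x := by
      rw [intervalIntegral.integral_comp_add_right (fun s => T (max s 0) x), zero_add]
    rw [this]
    apply intervalIntegral.integral_congr
    intro s hs
    rw [Set.uIcc_of_le ht] at hs
    have h4 := hT.map_add h s hh'.le hs.1
    simp only [max_eq_left hs.1, max_eq_left (add_nonneg hs.1 hh'.le)]
    rw [add_comm, h4]
    rfl
  change _ = (h : ℂ)⁻¹ • (T h (F t) - F t)
  rw [key]
  congr 1
  abel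

theorem graph_orbit (hT : IsC0Semigroup T) {x y : H} (h : GeneratorGraph T x y) {t : ℝ}
    (ht : 0 ≤ t) : GeneratorGraph T (T t x) (T t y) := by
  refine (((T t).continuous.tendsto y).comp h).congr' ?_
  filter_upwards [self_mem_nhdsWithin] with u hu
  have hu' : (0 : ℝ) ≤ u := le_of_lt hu
  have h1 : T t (T u x) = T u (T t x) := by
    rw [← ContinuousLinearMap.comp_apply, ← hT.map_add t u ht hu', add_comm,
      hT.map_add u t hu' ht]
    rfl
  simp [h1]

theorem integral_eq_sub_of_graph [CompleteSpace H] (hT : IsC0Semigroup T) {x y : H}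
    (h : GeneratorGraph T x y) {t : ℝ} (ht : 0 ≤ t) :
    ∫ s in (0 : ℝ)..t, T s y = T t x - x := by
  have h1 := intervalIntegral.integral_eq_sub_of_hasDeriv_right (f := fun s => T s x)
    (f' := fun s => T s y) (a := 0) (b := t) ?_ ?_ (hT.intervalIntegrable_orbit y ht)
  · simpa [hT.map_zero] using h1
  · rw [Set.uIcc_of_le ht]
    exact (hT.strong_continuity x).mono Set.Icc_subset_Ici_self
  · intro s hs
    rw [min_eq_left ht, max_eq_right ht] at hs
    rw [hasDerivWithinAt_iff_tendsto_slope' (by simp)]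
    have h2 := hT.graph_orbit h hs.1.le
    have h3 : Tendsto (fun u : ℝ => u - s) (𝓝[>] s) (𝓝[>] 0) := by
      apply tendsto_nhdsWithin_of_tendsto_nhds_of_eventually_within
      · have : Continuous (fun u : ℝ => u - s) := by fun_prop
        simpa using (this.tendsto s).mono_left nhdsWithin_le_nhds
      · filter_upwards [self_mem_nhdsWithin] with u hu
        simpa using hu
    refine (h2.comp h3).congr' ?_
    filter_upwards [self_mem_nhdsWithin] with u hu
    have hu' : s < u := hu
    have h4 := hT.map_add (u - s) s (by linarith) hs.1.le
    rw [sub_add_cancel] at h4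
    simp only [Function.comp_apply, slope_def_module]
    rw [h4, ← Complex.ofReal_inv, Complex.coe_smul]
    rfl

theorem graph_of_integral_eq_sub [CompleteSpace H] (hT : IsC0Semigroup T) {x y : H}
    (h : ∀ t : ℝ, 0 ≤ t → ∫ s in (0 : ℝ)..t, T s y = T t x - x) : GeneratorGraph T x y := by
  have hd := ((hT.continuous_orbit y).integral_hasStrictDerivAt 0 0).hasDerivAt
  have h1 := hd.tendsto_slope_zero_right
  simp only [max_self, hT.map_zero, one_apply_eq_self] at h1
  refine h1.congr' ?_
  filter_upwards [self_mem_nhdsWithin] with u hu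
  have hu' : (0 : ℝ) ≤ u := le_of_lt hu
  rw [zero_add, intervalIntegral_orbit y hu', h u hu', intervalIntegral.integral_same, sub_zero,
    ← Complex.ofReal_inv, Complex.coe_smul]

/-- For `x` in the domain of the generator the orbit is differentiable on `(0, ∞)`. -/
theorem hasDerivAt_of_graph [CompleteSpace H] (hT : IsC0Semigroup T) {x y : H}
    (h : GeneratorGraph T x y) {t : ℝ} (ht : 0 < t) :
    HasDerivAt (fun s => T s x) (T t y) t := by
  have hd := ((hT.continuous_orbit y).integral_hasStrictDerivAt 0 t).hasDerivAt.const_add x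
  rw [max_eq_left ht.le] at hd
  refine hd.congr_of_eventuallyEq ?_
  filter_upwards [Ioi_mem_nhds ht] with u hu
  have hu' : (0 : ℝ) ≤ u := le_of_lt hu
  rw [intervalIntegral_orbit y hu', hT.integral_eq_sub_of_graph h hu', add_sub_cancel]

theorem tendsto_intervalIntegral_orbit [CompleteSpace H] (hT : IsC0Semigroup T) {ι : Type*}
    {l : Filter ι} {y : ι → H} {z : H} (hy : Tendsto y l (𝓝 z)) {t : ℝ} (ht : 0 ≤ t) :
    Tendsto (fun i => ∫ s in (0 : ℝ)..t, T s (y i)) l (𝓝 (∫ s in (0 : ℝ)..t, T s z)) := by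
  obtain ⟨K, ω, hK1, hω, hK⟩ := hT.exists_norm_le_exp
  rw [tendsto_iff_norm_sub_tendsto_zero] at hy ⊢
  have hb : Tendsto (fun i => K * Real.exp (ω * t) * ‖y i - z‖ * |t - 0|) l (𝓝 0) := by
    simpa using (hy.const_mul (K * Real.exp (ω * t))).mul_const |t - 0|
  refine squeeze_zero (fun _ => norm_nonneg _) (fun i => ?_) hb
  rw [← intervalIntegral.integral_sub (hT.intervalIntegrable_orbit _ ht)
    (hT.intervalIntegrable_orbit _ ht)]
  refine intervalIntegral.norm_integral_le_of_norm_le_const fun s hs => ?_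
  rw [Set.uIoc_of_le ht] at hs
  rw [← map_sub]
  refine ((T s).le_opNorm _).trans ?_
  gcongr
  refine (hK s hs.1.le).trans ?_
  gcongr
  exact hs.2

/-- The generator is closed. -/
theorem graph_closed [CompleteSpace H] (hT : IsC0Semigroup T) {ι : Type*} {l : Filter ι} [l.NeBot]
    {u v : ι → H} {x y : H} (h : ∀ i, GeneratorGraph T (u i) (v i)) (hu : Tendsto u l (𝓝 x))
    (hv : Tendsto v l (𝓝 y)) : GeneratorGraph T x y := by
  refine hT.graph_of_integral_eq_sub fun t ht => ?_
  refine tendsto_nhds_unique (hT.tendsto_intervalIntegral_orbit hv ht) ?_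
  refine ((((T t).continuous.tendsto x).comp hu).sub hu).congr fun i => ?_
  rw [hT.integral_eq_sub_of_graph (h i) ht]
  rfl

/-- The generator is densely defined. -/
theorem exists_seq_graph [CompleteSpace H] (hT : IsC0Semigroup T) (x : H) :
    ∃ u v : ℕ → H, (∀ n, GeneratorGraph T (u n) (v n)) ∧ Tendsto u atTop (𝓝 x) := by
  have hd := ((hT.continuous_orbit x).integral_hasStrictDerivAt 0 0).hasDerivAt
  have h1 := hd.tendsto_slope_zero_right
  simp only [max_self, hT.map_zero, one_apply_eq_self] at h1
  have h2 : Tendsto (fun n : ℕ => 1 / ((n : ℝ) + 1)) atTop (𝓝[>] 0) :=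
    tendsto_nhdsWithin_of_tendsto_nhds_of_eventually_within _
      tendsto_one_div_add_atTop_nhds_zero_nat (Eventually.of_forall fun n => by
        simp only [Set.mem_Ioi]; positivity)
  refine ⟨fun n => ((1 / ((n : ℝ) + 1) : ℝ) : ℂ)⁻¹ • ∫ s in (0 : ℝ)..(1 / ((n : ℝ) + 1)), T s x,
    fun n => ((1 / ((n : ℝ) + 1) : ℝ) : ℂ)⁻¹ • (T (1 / ((n : ℝ) + 1)) x - x), fun n => ?_, ?_⟩
  · have h3 := hT.graph_integral x (t := 1 / ((n : ℝ) + 1)) (by positivity)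
    refine (h3.const_smul ((1 / ((n : ℝ) + 1) : ℝ) : ℂ)⁻¹).congr fun h => ?_
    rw [map_smul, ← smul_sub, smul_comm]
  · refine (h1.comp h2).congr fun n => ?_
    simp only [Function.comp_apply, zero_add, intervalIntegral.integral_same, sub_zero]
    rw [intervalIntegral_orbit x (by positivity), ← Complex.ofReal_inv, Complex.coe_smul]

theorem exists_orbit_integral_clm [CompleteSpace H] (hT : IsC0Semigroup T) {t C : ℝ} (ht : 0 ≤ t)
    (hC0 : 0 ≤ C) (hC : ∀ s, 0 ≤ s → s ≤ t → ‖T s‖ ≤ C) :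
    ∃ Q : H →L[ℂ] H, (∀ x, Q x = ∫ s in (0 : ℝ)..t, T s x) ∧ ‖Q‖ ≤ C * t := by
  let L : H →ₗ[ℂ] H :=
    { toFun := fun x => ∫ s in (0 : ℝ)..t, T s x
      map_add' := fun x y => by
        simp only [_root_.map_add]
        exact intervalIntegral.integral_add (hT.intervalIntegrable_orbit x ht)
          (hT.intervalIntegrable_orbit y ht)
      map_smul' := fun c x => by
        simp only [map_smul, RingHom.id_apply]
        exact intervalIntegral.integral_smul c _ }
  refine ⟨L.mkContinuous (C * t) fun x => ?_, fun x => rfl,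
    L.mkContinuous_norm_le (by positivity) _⟩
  have h : ‖∫ s in (0 : ℝ)..t, T s x‖ ≤ C * ‖x‖ * |t - 0| := by
    refine intervalIntegral.norm_integral_le_of_norm_le_const fun s hs => ?_
    rw [Set.uIoc_of_le ht] at hs
    exact (T s).le_of_opNorm_le (hC s hs.1.le hs.2) x
  rw [sub_zero, abs_of_nonneg ht] at h
  calc ‖L x‖ ≤ C * ‖x‖ * t := h
    _ = C * t * ‖x‖ := by ring

end IsC0Semigroup

namespace GeneratorGraph

variable {T : ℝ → H →L[ℂ] H} {x y u v : H}

theorem add (h : GeneratorGraph T x y) (h' : GeneratorGraph T u v) :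
    GeneratorGraph T (x + u) (y + v) := by
  refine (Tendsto.add h h').congr fun r => ?_
  rw [← smul_add, map_add]
  congr 1
  abel

theorem smul (h : GeneratorGraph T x y) (c : ℂ) : GeneratorGraph T (c • x) (c • y) := by
  refine (Tendsto.const_smul h c).congr fun r => ?_
  rw [map_smul, ← smul_sub, smul_comm]

theorem sub (h : GeneratorGraph T x y) (h' : GeneratorGraph T u v) :
    GeneratorGraph T (x - u) (y - v) := by
  simpa [sub_eq_add_neg] using h.add (h'.smul (-1))

end GeneratorGraph

/-- A criterion for the invertibility of `lam + A` in terms of the graph of the generator. -/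
theorem IsGenerator.isResolventAt {T : ℝ → H →L[ℂ] H} {A : H →ₗ.[ℂ] H} (hgen : IsGenerator T A)
    {lam : ℂ} {R : H →L[ℂ] H} (hR : ∀ x, GeneratorGraph T (R x) (lam • R x - x))
    (hinj : ∀ x, GeneratorGraph T x (lam • x) → x = 0) : IsResolventAt A lam R := by
  refine ⟨fun x => ?_, fun x => ?_⟩
  · obtain ⟨hx, hA⟩ := (hgen.graph_iff (x := R x) (y := x - lam • R x)).1
      (by simpa using hR x)
    exact ⟨hx, by rw [hA]; abel⟩
  · have h1 : GeneratorGraph T (x : H) (-(A x)) := hgen.2 x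
    have h2 := (hR (lam • (x : H) + A x)).sub h1
    refine sub_eq_zero.1 (hinj _ ?_)
    convert h2 using 1
    rw [smul_sub]
    abel

/-- If `‖A T(t)‖ ≤ |η| / 2` for some `t > 0`, then `iη + A` is invertible with an explicit bound
on its inverse. -/
theorem IsGenerator.exists_resolvent_of_norm_le [CompleteSpace H] {T : ℝ → H →L[ℂ] H}
    {A : H →ₗ.[ℂ] H} (hT : IsC0Semigroup T) (hgen : IsGenerator T A) {t K η : ℝ} (ht : 0 ≤ t)
    (hη : η ≠ 0) (hK0 : 0 ≤ K) (hK : ∀ s, 0 ≤ s → s ≤ t → ‖T s‖ ≤ K) {B : H →L[ℂ] H}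
    (hB : ∀ x, GeneratorGraph T (T t x) (-(B x))) (hBn : ‖B‖ ≤ |η| / 2) :
    ∃ Rop : H →L[ℂ] H, IsResolventAt A (Complex.I * η) Rop ∧
      ‖Rop‖ ≤ 2 * (K * t + K * |η|⁻¹) := by
  set c : ℂ := Complex.I * η with hc
  have hη' : 0 < |η| := abs_pos.2 hη
  have hcn : ‖c‖ = |η| := by simp [hc]
  have hc0 : c ≠ 0 := norm_pos_iff.1 (hcn ▸ hη')
  have hexp : ∀ s : ℝ, ‖Complex.exp (-(c * s))‖ = 1 := fun s => by
    rw [Complex.norm_exp]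
    simp [hc]
  have hS := hT.rescale c
  have hSK : ∀ s, 0 ≤ s → s ≤ t → ‖Complex.exp (-(c * s)) • T s‖ ≤ K := fun s h0 h1 => by
    rw [norm_smul, hexp, one_mul]
    exact hK s h0 h1
  obtain ⟨Q, hQ, hQn⟩ := hS.exists_orbit_integral_clm ht hK0 hSK
  set e : ℂ := Complex.exp (-(c * t)) with he
  have hen : ‖e‖ = 1 := hexp t
  have hce : ‖c⁻¹ * e‖ = |η|⁻¹ := by rw [norm_mul, norm_inv, hcn, hen, mul_one]
  set P : H →L[ℂ] H := Q + (c⁻¹ * e) • T t with hP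
  set D : H →L[ℂ] H := (c⁻¹ * e) • B with hD
  have hDn : ‖D‖ ≤ 1 / 2 := by
    rw [hD, norm_smul, hce]
    calc |η|⁻¹ * ‖B‖ ≤ |η|⁻¹ * (|η| / 2) := by gcongr
      _ = 1 / 2 := by field_simp
  have hPn : ‖P‖ ≤ K * t + K * |η|⁻¹ := by
    refine (norm_add_le _ _).trans (add_le_add hQn ?_)
    rw [norm_smul, hce, mul_comm]
    gcongr
    exact hK t ht le_rfl
  have hPg : ∀ x, GeneratorGraph T (P x) (c • P x - (x + D x)) := fun x => by
    have h1 := (hS.graph_integral x ht).of_rescale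
    rw [← hQ x] at h1
    have h2 := h1.add ((hB x).smul (c⁻¹ * e))
    have hPx : P x = Q x + (c⁻¹ * e) • T t x := rfl
    have hDx : D x = (c⁻¹ * e) • B x := rfl
    have hcP : c • P x = c • Q x + e • T t x := by
      rw [hPx, smul_add, smul_smul, mul_inv_cancel_left₀ hc0]
    rw [hcP, hPx, hDx]
    convert h2 using 1
    rw [smul_neg, smul_apply, ← he]
    abel
  have hunit : IsUnit (1 - (-D)) :=
    isUnit_one_sub_of_norm_lt_one (by rw [norm_neg]; linarith)
  obtain ⟨V, hV⟩ := hunit.exists_right_inv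
  have hV' : ∀ x, V x + D (V x) = x := fun x => by
    have := congrArg (fun L : H →L[ℂ] H => L x) hV
    simpa using this
  have hVn : ‖V‖ ≤ 2 := by
    refine V.opNorm_le_bound (by norm_num) fun x => ?_
    have h1 : V x = x - D (V x) := eq_sub_of_add_eq (hV' x)
    have h2 : ‖V x‖ ≤ ‖x‖ + ‖D (V x)‖ := by
      conv_lhs => rw [h1]
      exact norm_sub_le _ _
    have h3 : ‖D (V x)‖ ≤ 1 / 2 * ‖V x‖ := D.le_of_opNorm_le hDn _
    linarith
  refine ⟨P ∘L V, hgen.isResolventAt (fun x => ?_) (fun w hw => ?_), ?_⟩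
  · have h1 := hPg (V x)
    rw [hV'] at h1
    exact h1
  · have h1 := hS.integral_eq_sub_of_graph (y := 0) (by simpa using hw.rescale c) ht
    simp only [map_zero, intervalIntegral.integral_zero] at h1
    have h2 : e • T t w = w := (sub_eq_zero.1 h1.symm)
    have h3 : c • T t w = -(B w) := by
      have := tendsto_nhds_unique (hT.graph_orbit hw ht) (hB w)
      simpa using this
    have h4 : D w = -w := by
      rw [hD, smul_apply, ← neg_neg (B w), ← h3, smul_neg, smul_smul, mul_right_comm,
        inv_mul_cancel₀ hc0, one_mul, h2]
    have h5 : ‖D w‖ ≤ 1 / 2 * ‖w‖ := D.le_of_opNorm_le hDn _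
    rw [h4, norm_neg] at h5
    exact norm_eq_zero.1 (le_antisymm (by linarith) (norm_nonneg _))
  · calc ‖P ∘L V‖ ≤ ‖P‖ * ‖V‖ := ContinuousLinearMap.opNorm_comp_le _ _
      _ ≤ (K * t + K * |η|⁻¹) * 2 := by gcongr
      _ = _ := mul_comm _ _

/-- Crandall–Pazy semigroups have resolvents decaying like `|η|^{-β}` on the imaginary axis. -/
theorem InCrandallPazy.exists_resolvent_bound [CompleteSpace H] {T : ℝ → H →L[ℂ] H}
    {A : H →ₗ.[ℂ] H} {β : ℝ} (hT : IsC0Semigroup T) (hgen : IsGenerator T A) (hβ0 : 0 < β)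
    (hβ1 : β ≤ 1) (h : InCrandallPazy T A β) :
    ∃ M R : ℝ, 0 < M ∧ 0 < R ∧ ∀ η : ℝ, R ≤ |η| →
      ∃ Rop : H →L[ℂ] H, IsResolventAt A (Complex.I * η) Rop ∧ ‖Rop‖ ≤ M * |η| ^ (-β) := by
  obtain ⟨B, hB, M, t₀, hM, ht₀, hBn⟩ := h
  obtain ⟨K, hK1, hK⟩ := hT.exists_norm_le_Icc
  have hK0 : 0 < K := by linarith
  set a : ℝ := min t₀ 1 with ha
  have ha0 : 0 < a := lt_min ht₀ one_pos
  refine ⟨2 * (K * (2 * M) ^ β + K), max 1 (2 * M / a ^ (1 / β)), by positivity, by positivity,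
    fun η hη => ?_⟩
  have hη1 : 1 ≤ |η| := (le_max_left _ _).trans hη
  have hη2 : 2 * M / a ^ (1 / β) ≤ |η| := (le_max_right _ _).trans hη
  have hη0 : 0 < |η| := by linarith
  set t : ℝ := (2 * M / |η|) ^ β with ht
  have ht0 : 0 < t := by positivity
  have hta : t ≤ a := by
    have h1 : 2 * M / |η| ≤ a ^ (1 / β) := by
      rw [div_le_iff₀ (by positivity)] at hη2
      rw [div_le_iff₀ hη0]
      linarith
    calc t ≤ (a ^ (1 / β)) ^ β := by rw [ht]; gcongr
      _ = a := by rw [← Real.rpow_mul ha0.le, one_div_mul_cancel hβ0.ne', Real.rpow_one]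
  have htinv : M * t ^ (-(1 / β)) = |η| / 2 := by
    rw [ht, ← Real.rpow_mul (by positivity), mul_neg, mul_one_div_cancel hβ0.ne', Real.rpow_neg_one]
    field_simp
  obtain ⟨Rop, hR, hRn⟩ := hgen.exists_resolvent_of_norm_le hT ht0.le (abs_pos.1 hη0) hK0.le
    (fun s h0 h1 => hK s h0 (h1.trans (hta.trans (min_le_right _ _))))
    (B := B t) (fun x => hgen.graph_iff.2 (by
      obtain ⟨hx, hBx⟩ := hB t ht0 x
      exact ⟨hx, hBx.symm⟩))
    (htinv ▸ hBn t ht0 (hta.trans (min_le_left _ _)))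
  refine ⟨Rop, hR, hRn.trans ?_⟩
  have h1 : t = (2 * M) ^ β * |η| ^ (-β) := by
    rw [ht, Real.div_rpow (by positivity) hη0.le, Real.rpow_neg hη0.le]
    rfl
  have h2 : |η|⁻¹ ≤ |η| ^ (-β) := by
    rw [← Real.rpow_neg_one]
    exact Real.rpow_le_rpow_of_exponent_le hη1 (by linarith)
  calc 2 * (K * t + K * |η|⁻¹) ≤ 2 * (K * ((2 * M) ^ β * |η| ^ (-β)) + K * |η| ^ (-β)) := by
        rw [← h1]; gcongr
    _ = _ := by ring

section ExpDecay

open MeasureTheory FourierTransform Set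

variable {E : Type*} [NormedAddCommGroup E]

theorem integrable_indicator_of_norm_le_exp {f : ℝ → E} {C b : ℝ} (hb : 0 < b)
    (hf : ContinuousOn f (Ioi 0)) (hfb : ∀ s, 0 < s → ‖f s‖ ≤ C * Real.exp (-(b * s))) :
    Integrable ((Ioi (0 : ℝ)).indicator f) := by
  rw [integrable_indicator_iff measurableSet_Ioi]
  have h := ((integrableOn_exp_mul_Ioi (neg_lt_zero.2 hb) 0).const_mul C)
  refine Integrable.mono' h (hf.aestronglyMeasurable measurableSet_Ioi) ?_
  filter_upwards [ae_restrict_mem measurableSet_Ioi] with s hs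
  simpa using hfb s hs

theorem memLp_two_indicator_of_norm_le_exp {f : ℝ → E} {C b : ℝ} (hb : 0 < b)
    (hf : ContinuousOn f (Ioi 0)) (hfb : ∀ s, 0 < s → ‖f s‖ ≤ C * Real.exp (-(b * s))) :
    MemLp ((Ioi (0 : ℝ)).indicator f) 2 := by
  have hm : AEStronglyMeasurable ((Ioi (0 : ℝ)).indicator f) volume :=
    (aestronglyMeasurable_indicator_iff measurableSet_Ioi).2
      (hf.aestronglyMeasurable measurableSet_Ioi)
  rw [memLp_two_iff_integrable_sq_norm hm]
  have h : Integrable ((Ioi (0 : ℝ)).indicator fun s => C ^ 2 * Real.exp (-(2 * b) * s)) := by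
    rw [integrable_indicator_iff measurableSet_Ioi]
    exact (integrableOn_exp_mul_Ioi (by linarith) 0).const_mul _
  refine h.mono' (hm.norm.pow 2) (Eventually.of_forall fun s => ?_)
  by_cases hs : s ∈ Ioi (0 : ℝ)
  · simp only [indicator_of_mem hs, norm_pow, norm_norm]
    calc ‖f s‖ ^ 2 ≤ (C * Real.exp (-(b * s))) ^ 2 := by gcongr; exact hfb s hs
      _ = C ^ 2 * Real.exp (-(2 * b) * s) := by
        rw [mul_pow, ← Real.exp_nat_mul]
        congr 2
        push_cast
        ring
  · simp [indicator_of_notMem hs]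

theorem eLpNorm_two_indicator_exp {b : ℝ} (hb : 0 < b) :
    eLpNorm ((Ioi (0 : ℝ)).indicator fun s => Real.exp (-(b * s))) 2 volume
      = ENNReal.ofReal ((1 / (2 * b)) ^ (1 / 2 : ℝ)) := by
  have hmem : MemLp ((Ioi (0 : ℝ)).indicator fun s => Real.exp (-(b * s))) 2 :=
    memLp_two_indicator_of_norm_le_exp (C := 1) hb (by fun_prop) fun s _ => by
      rw [one_mul, Real.norm_eq_abs, Real.abs_exp]
  rw [hmem.eLpNorm_eq_integral_rpow_norm (by norm_num) (by norm_num)]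
  have hint : ∫ s, ‖(Ioi (0 : ℝ)).indicator (fun s => Real.exp (-(b * s))) s‖ ^ (2 : ℝ)
      = 1 / (2 * b) := by
    have : (fun s => ‖(Ioi (0 : ℝ)).indicator (fun s => Real.exp (-(b * s))) s‖ ^ (2 : ℝ))
        = (Ioi (0 : ℝ)).indicator fun s => Real.exp (-(2 * b) * s) := by
      funext s
      by_cases hs : s ∈ Ioi (0 : ℝ)
      · simp only [indicator_of_mem hs, Real.norm_eq_abs, Real.abs_exp]
        rw [← Real.exp_mul]
        congr 1
        ring
      · simp [indicator_of_notMem hs]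
    rw [this, integral_indicator measurableSet_Ioi, integral_exp_mul_Ioi (by linarith)]
    simp
  simp only [ENNReal.toReal_ofNat]
  rw [hint]
  norm_num

theorem fourier_indicator_moment (S : ℝ → H →L[ℂ] H) (n : ℕ) (x : H) (ξ : ℝ) :
    𝓕 ((Ioi (0 : ℝ)).indicator fun s : ℝ => (s ^ n / n.factorial : ℝ) • S s x) ξ
      = ∫ s in Ioi (0 : ℝ), (s ^ n / n.factorial : ℝ) •
          (Complex.exp (-(2 * Real.pi * ξ * Complex.I * s)) • S s) x := by
  rw [Real.fourier_eq', ← integral_indicator measurableSet_Ioi]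
  congr 1
  funext s
  by_cases hs : s ∈ Ioi (0 : ℝ)
  · simp only [indicator_of_mem hs, smul_apply]
    rw [smul_comm]
    congr 3
    simp
    ring
  · simp [indicator_of_notMem hs]

end ExpDecay

/-- `S` is a strongly continuous semigroup with `‖S(s)‖ ≤ K e^{-bs}`. -/
structure IsExpStable_s0 (S : ℝ → H →L[ℂ] H) (K b : ℝ) : Prop where
  isC0Semigroup : IsC0Semigroup S
  rate_pos : 0 < b
  norm_le : ∀ s, 0 ≤ s → ‖S s‖ ≤ K * Real.exp (-(b * s))

namespace IsExpStable_s0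

open MeasureTheory FourierTransform Set

variable {S : ℝ → H →L[ℂ] H} {K b : ℝ}

theorem rescale (hS : IsExpStable_s0 S K b) {c : ℂ} (hc : c.re = 0) :
    IsExpStable_s0 (fun s : ℝ => Complex.exp (-(c * s)) • S s) K b where
  isC0Semigroup := hS.isC0Semigroup.rescale c
  rate_pos := hS.rate_pos
  norm_le s hs := by
    rw [norm_smul, Complex.norm_exp]
    simpa [hc] using hS.norm_le s hs

theorem continuousOn_moment (hS : IsExpStable_s0 S K b) (n : ℕ) (x : H) :
    ContinuousOn (fun s : ℝ => (s ^ n / n.factorial : ℝ) • S s x) (Ici 0) :=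
  have h : Continuous fun s : ℝ => (s ^ n / n.factorial : ℝ) := by fun_prop
  h.continuousOn.smul (hS.isC0Semigroup.strong_continuity x)

theorem norm_moment_le (hS : IsExpStable_s0 S K b) (n : ℕ) (x : H) {s : ℝ} (hs : 0 ≤ s) :
    ‖(s ^ n / n.factorial : ℝ) • S s x‖ ≤
      (2 / b) ^ n * (K * ‖x‖) * Real.exp (-(b / 2 * s)) := by
  have hb := hS.rate_pos
  have h1 : s ^ n / n.factorial ≤ (2 / b) ^ n * Real.exp (b / 2 * s) := by
    have h2 := Real.pow_div_factorial_le_exp (b / 2 * s) (by positivity) n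
    calc s ^ n / n.factorial = (2 / b) ^ n * ((b / 2 * s) ^ n / n.factorial) := by
          rw [← mul_div_assoc, ← mul_pow]
          congr 2
          field_simp
      _ ≤ _ := by gcongr
  have h3 : ‖S s x‖ ≤ K * Real.exp (-(b * s)) * ‖x‖ := (S s).le_of_opNorm_le (hS.norm_le s hs) x
  rw [norm_smul, Real.norm_of_nonneg (by positivity)]
  calc s ^ n / n.factorial * ‖S s x‖
      ≤ (2 / b) ^ n * Real.exp (b / 2 * s) * (K * Real.exp (-(b * s)) * ‖x‖) := by gcongr
    _ = (2 / b) ^ n * (K * ‖x‖) * (Real.exp (b / 2 * s) * Real.exp (-(b * s))) := by ring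
    _ = _ := by
      rw [← Real.exp_add]
      congr 2
      ring

theorem integrable_moment (hS : IsExpStable_s0 S K b) (n : ℕ) (x : H) :
    Integrable ((Ioi (0 : ℝ)).indicator fun s : ℝ => (s ^ n / n.factorial : ℝ) • S s x) :=
  integrable_indicator_of_norm_le_exp (half_pos hS.rate_pos)
    ((hS.continuousOn_moment n x).mono Ioi_subset_Ici_self)
    fun _ hs => hS.norm_moment_le n x hs.le

theorem integrableOn_moment (hS : IsExpStable_s0 S K b) (n : ℕ) (x : H) :
    IntegrableOn (fun s : ℝ => (s ^ n / n.factorial : ℝ) • S s x) (Ioi 0) :=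
  (integrable_indicator_iff measurableSet_Ioi).1 (hS.integrable_moment n x)

theorem memLp_moment (hS : IsExpStable_s0 S K b) (n : ℕ) (x : H) :
    MemLp ((Ioi (0 : ℝ)).indicator fun s : ℝ => (s ^ n / n.factorial : ℝ) • S s x) 2 :=
  memLp_two_indicator_of_norm_le_exp (half_pos hS.rate_pos)
    ((hS.continuousOn_moment n x).mono Ioi_subset_Ici_self)
    fun _ hs => hS.norm_moment_le n x hs.le

theorem tendsto_moment (hS : IsExpStable_s0 S K b) (n : ℕ) (x : H) :
    Tendsto (fun s : ℝ => (s ^ n / n.factorial : ℝ) • S s x) atTop (𝓝 0) := by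
  have hb := hS.rate_pos
  have h1 : Tendsto (fun s : ℝ => Real.exp (-(b / 2 * s))) atTop (𝓝 0) :=
    Real.tendsto_exp_neg_atTop_nhds_zero.comp (tendsto_id.const_mul_atTop (half_pos hb))
  have h2 := h1.const_mul ((2 / b) ^ n * (K * ‖x‖))
  rw [mul_zero] at h2
  refine squeeze_zero_norm' ?_ h2
  filter_upwards [eventually_ge_atTop 0] with s hs
  exact hS.norm_moment_le n x hs

theorem integrableOn_orbit (hS : IsExpStable_s0 S K b) (x : H) :
    IntegrableOn (fun s : ℝ => S s x) (Ioi 0) := by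
  simpa using hS.integrableOn_moment 0 x

theorem tendsto_orbit (hS : IsExpStable_s0 S K b) (x : H) :
    Tendsto (fun s : ℝ => S s x) atTop (𝓝 0) := by
  simpa using hS.tendsto_moment 0 x

variable [CompleteSpace H]

theorem integral_orbit_of_graph (hS : IsExpStable_s0 S K b) {x y : H} (h : GeneratorGraph S x y) :
    ∫ s in Ioi (0 : ℝ), S s y = -x := by
  refine tendsto_nhds_unique
    (intervalIntegral_tendsto_integral_Ioi 0 (hS.integrableOn_orbit y) tendsto_id) ?_
  have h1 := (hS.tendsto_orbit x).sub_const x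
  rw [zero_sub] at h1
  refine h1.congr' ?_
  filter_upwards [eventually_ge_atTop 0] with t ht
  exact (hS.isC0Semigroup.integral_eq_sub_of_graph h ht).symm

theorem integral_moment_succ_of_graph (hS : IsExpStable_s0 S K b) {x y : H}
    (h : GeneratorGraph S x y) (n : ℕ) :
    ∫ s in Ioi (0 : ℝ), (s ^ (n + 1) / (n + 1).factorial : ℝ) • S s y
      = -∫ s in Ioi (0 : ℝ), (s ^ n / n.factorial : ℝ) • S s x := by
  have hd : ∀ s ∈ Ioi (0 : ℝ),
      HasDerivAt (fun s : ℝ => (s ^ (n + 1) / (n + 1).factorial : ℝ) • S s x)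
        ((s ^ (n + 1) / (n + 1).factorial : ℝ) • S s y + (s ^ n / n.factorial : ℝ) • S s x) s := by
    intro s hs
    have h1 : HasDerivAt (fun s : ℝ => s ^ (n + 1) / ((n + 1).factorial : ℝ))
        (s ^ n / n.factorial) s := by
      have h2 := (hasDerivAt_pow (n + 1) s).div_const ((n + 1).factorial : ℝ)
      have h4 : ((n + 1 : ℕ) : ℝ) * s ^ (n + 1 - 1) / ((n + 1).factorial : ℝ)
          = s ^ n / n.factorial := by
        rw [Nat.factorial_succ, Nat.cast_mul, Nat.add_sub_cancel,
          mul_div_mul_left _ _ (Nat.cast_ne_zero.2 n.succ_ne_zero)]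
      rwa [h4] at h2
    exact h1.smul (hS.isC0Semigroup.hasDerivAt_of_graph h hs)
  have h3 := integral_Ioi_of_hasDerivAt_of_tendsto
    (((hS.continuousOn_moment (n + 1) x) 0 self_mem_Ici)) hd
    ((hS.integrableOn_moment (n + 1) y).add (hS.integrableOn_moment n x))
    (hS.tendsto_moment (n + 1) x)
  rw [integral_add (hS.integrableOn_moment (n + 1) y) (hS.integrableOn_moment n x)] at h3
  rw [eq_neg_iff_add_eq_zero, h3]
  simp

/-- The Laplace transform at `0` is minus the inverse of the generator. -/
theorem exists_inverse (hS : IsExpStable_s0 S K b) :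
    ∃ R : H →L[ℂ] H, (∀ x, R x = ∫ s in Ioi (0 : ℝ), S s x) ∧ ‖R‖ ≤ K / b ∧
      ∀ x, GeneratorGraph S (R x) (-x) := by
  have hb := hS.rate_pos
  have hK : 0 ≤ K := by
    simpa using (norm_nonneg _).trans (hS.norm_le 0 le_rfl)
  let L : H →ₗ[ℂ] H :=
    { toFun := fun x => ∫ s in Ioi (0 : ℝ), S s x
      map_add' := fun x y => by
        simp only [map_add]
        exact integral_add (hS.integrableOn_orbit x) (hS.integrableOn_orbit y)
      map_smul' := fun c x => by
        simp only [map_smul, RingHom.id_apply]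
        exact integral_smul c _ }
  refine ⟨L.mkContinuous (K / b) fun x => ?_, fun x => rfl,
    L.mkContinuous_norm_le (by positivity) _, fun x => ?_⟩
  · have h1 : ‖∫ s in Ioi (0 : ℝ), S s x‖ ≤
        ∫ s in Ioi (0 : ℝ), K * ‖x‖ * Real.exp (-b * s) := by
      refine norm_integral_le_of_norm_le
        ((integrableOn_exp_mul_Ioi (neg_lt_zero.2 hb) 0).const_mul _) ?_
      filter_upwards [ae_restrict_mem measurableSet_Ioi] with s hs
      refine ((S s).le_of_opNorm_le (hS.norm_le s (le_of_lt hs)) x).trans (le_of_eq ?_)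
      rw [neg_mul]
      ring
    rw [integral_const_mul, integral_exp_mul_Ioi (neg_lt_zero.2 hb)] at h1
    refine h1.trans (le_of_eq ?_)
    simp only [mul_zero, Real.exp_zero]
    field_simp
  · have h1 := intervalIntegral_tendsto_integral_Ioi 0 (hS.integrableOn_orbit x)
      (tendsto_natCast_atTop_atTop (R := ℝ))
    have h2 := ((hS.tendsto_orbit x).sub_const x).comp (tendsto_natCast_atTop_atTop (R := ℝ))
    rw [zero_sub] at h2
    exact hS.isC0Semigroup.graph_closed
      (fun n : ℕ => hS.isC0Semigroup.graph_integral x n.cast_nonneg) h1 h2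

theorem integral_moment_eq_pow (hS : IsExpStable_s0 S K b) {R : H →L[ℂ] H}
    (hR : ∀ x, R x = ∫ s in Ioi (0 : ℝ), S s x) (hRg : ∀ x, GeneratorGraph S (R x) (-x))
    (n : ℕ) (x : H) :
    ∫ s in Ioi (0 : ℝ), (s ^ n / n.factorial : ℝ) • S s x = (R ^ (n + 1)) x := by
  induction n generalizing x with
  | zero => simp [hR]
  | succ n ih =>
    have h1 := hS.integral_moment_succ_of_graph (hRg x) n
    simp only [map_neg, smul_neg, integral_neg] at h1
    rw [neg_inj.1 h1, ih, pow_succ _ (n + 1)]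
    rfl

/-- Resolvent estimates on a vertical line control orbit moments in `L²`, by Plancherel. -/
theorem eLpNorm_moment_le (hS : IsExpStable_s0 S K b) {R : ℝ → H →L[ℂ] H} {a : ℂ} {m : ℕ} {C : ℝ}
    (hR : ∀ (ξ : ℝ) (x : H), R ξ x =
      ∫ s in Ioi (0 : ℝ), (Complex.exp (-(2 * Real.pi * ξ * Complex.I * s)) • S s) x)
    (hRg : ∀ (ξ : ℝ) (x : H), GeneratorGraph
      (fun s : ℝ => Complex.exp (-(2 * Real.pi * ξ * Complex.I * s)) • S s) (R ξ x) (-x))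
    (hC : ∀ ξ : ℝ, ‖a + 2 * Real.pi * ξ * Complex.I‖ * ‖R ξ‖ ^ (m + 1) + ‖R ξ‖ ^ m ≤ C)
    {x y : H} (h : GeneratorGraph S x (y - a • x)) :
    eLpNorm ((Ioi (0 : ℝ)).indicator
        fun s : ℝ => (s ^ (m + 1) / (m + 1).factorial : ℝ) • S s y) 2 volume
      ≤ ENNReal.ofReal C * eLpNorm ((Ioi (0 : ℝ)).indicator fun s : ℝ => S s x) 2 volume := by
  have hstab : ∀ ξ : ℝ, IsExpStable_s0
      (fun s : ℝ => Complex.exp (-(2 * Real.pi * ξ * Complex.I * s)) • S s) K b := fun ξ =>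
    hS.rescale (c := 2 * Real.pi * ξ * Complex.I) (by simp)
  have hx : (Ioi (0 : ℝ)).indicator (fun s : ℝ => S s x)
      = (Ioi (0 : ℝ)).indicator fun s : ℝ => (s ^ 0 / (0 : ℕ).factorial : ℝ) • S s x := by
    simp
  rw [hx, ← eLpNorm_two_fourier_eq (hS.integrable_moment _ _) (hS.memLp_moment _ _),
    ← eLpNorm_two_fourier_eq (hS.integrable_moment _ _) (hS.memLp_moment _ _)]
  refine eLpNorm_le_mul_eLpNorm_of_ae_le_mul (Eventually.of_forall fun ξ => ?_) 2
  rw [fourier_indicator_moment, fourier_indicator_moment,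
    (hstab ξ).integral_moment_eq_pow (hR ξ) (hRg ξ),
    (hstab ξ).integral_moment_eq_pow (hR ξ) (hRg ξ)]
  have h1 := (hstab ξ).integral_orbit_of_graph (h.rescale (2 * Real.pi * ξ * Complex.I))
  rw [← hR] at h1
  have h2 : R ξ y = (a + 2 * Real.pi * ξ * Complex.I) • R ξ x - x := by
    rw [sub_sub, ← add_smul, map_sub, map_smul, sub_eq_iff_eq_add] at h1
    rw [h1]
    abel
  have h3 : (R ξ ^ (m + 1 + 1)) y
      = (a + 2 * Real.pi * ξ * Complex.I) • (R ξ ^ (m + 1)) (R ξ x) - (R ξ ^ m) (R ξ x) := by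
    rw [pow_succ]
    change (R ξ ^ (m + 1)) (R ξ y) = _
    rw [h2, map_sub, map_smul]
    congr 1
  rw [h3, zero_add, pow_one]
  calc _ ≤ ‖a + 2 * Real.pi * ξ * Complex.I‖ * ‖(R ξ ^ (m + 1)) (R ξ x)‖
          + ‖(R ξ ^ m) (R ξ x)‖ := by
        rw [← norm_smul]
        exact norm_sub_le _ _
    _ ≤ ‖a + 2 * Real.pi * ξ * Complex.I‖ * (‖R ξ‖ ^ (m + 1) * ‖R ξ x‖)
          + ‖R ξ‖ ^ m * ‖R ξ x‖ := by
        have hp : ∀ k : ℕ, ‖(R ξ ^ k) (R ξ x)‖ ≤ ‖R ξ‖ ^ k * ‖R ξ x‖ := fun k => by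
          induction k with
          | zero => simp
          | succ k ih =>
            rw [pow_succ']
            change ‖R ξ ((R ξ ^ k) (R ξ x))‖ ≤ _
            refine ((R ξ).le_opNorm _).trans ?_
            rw [pow_succ', mul_assoc]
            gcongr
        gcongr
        · exact hp (m + 1)
        · exact hp m
    _ = (‖a + 2 * Real.pi * ξ * Complex.I‖ * ‖R ξ‖ ^ (m + 1) + ‖R ξ‖ ^ m) * ‖R ξ x‖ := by ring
    _ ≤ C * ‖R ξ x‖ := by
        gcongr
        exact hC ξ

end IsExpStable_s0

/-- If `lam = a + iη` and `a ‖(iη + A)⁻¹‖ ≤ 1/2`, then `‖(lam + A)⁻¹‖ ≤ 2 ‖(iη + A)⁻¹‖`. -/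
theorem IsResolventAt.norm_le_two_mul {T : ℝ → H →L[ℂ] H} {A : H →ₗ.[ℂ] H}
    (hgen : IsGenerator T A) {a : ℝ} (ha : 0 ≤ a) {z : ℂ} {Q R : H →L[ℂ] H}
    (hQ : IsResolventAt A z Q)
    (hR : ∀ x, GeneratorGraph T (R x) (-x + z • R x + (a : ℂ) • R x))
    (h : a * ‖Q‖ ≤ 1 / 2) : ‖R‖ ≤ 2 * ‖Q‖ := by
  refine R.opNorm_le_bound (by positivity) fun x => ?_
  obtain ⟨hx, hA⟩ := (hgen.graph_iff (x := R x) (y := x - z • R x - (a : ℂ) • R x)).1 (by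
    convert hR x using 1
    abel)
  have h1 : Q (z • R x + A ⟨R x, hx⟩) = R x := hQ.2 ⟨R x, hx⟩
  have h2 : R x = Q (x - (a : ℂ) • R x) := by
    have e : z • R x + (x - z • R x - (a : ℂ) • R x) = x - (a : ℂ) • R x := by abel
    rw [hA, e] at h1
    exact h1.symm
  have h3 : ‖R x‖ ≤ ‖Q‖ * (‖x‖ + a * ‖R x‖) := by
    conv_lhs => rw [h2]
    refine (Q.le_opNorm _).trans ?_
    gcongr
    refine (norm_sub_le _ _).trans ?_
    rw [norm_smul, Complex.norm_real, Real.norm_of_nonneg ha]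
  have h4 : a * ‖Q‖ * ‖R x‖ ≤ 1 / 2 * ‖R x‖ := by gcongr
  linarith

section Smoothing

open MeasureTheory Set

variable [CompleteSpace H] {T : ℝ → H →L[ℂ] H} {K ω t : ℝ}

theorem IsC0Semigroup.isExpStable_rescale (hT : IsC0Semigroup T)
    (hK : ∀ s, 0 ≤ s → ‖T s‖ ≤ K * Real.exp (ω * s)) (hK0 : 0 ≤ K) (ht : 0 < t)
    (hωt : ω * t ≤ 1 / 2) :
    IsExpStable_s0 (fun s : ℝ => Complex.exp (-(((t⁻¹ : ℝ) : ℂ) * s)) • T s) K (1 / (2 * t)) where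
  isC0Semigroup := hT.rescale _
  rate_pos := by positivity
  norm_le s hs := by
    have h1 : ‖Complex.exp (-(((t⁻¹ : ℝ) : ℂ) * s))‖ = Real.exp (-(t⁻¹ * s)) := by
      rw [Complex.norm_exp, ← Complex.ofReal_mul, ← Complex.ofReal_neg, Complex.ofReal_re]
    have h2 : ω ≤ 1 / (2 * t) := by
      rw [le_div_iff₀ (by positivity)]
      linarith
    rw [norm_smul, h1]
    calc Real.exp (-(t⁻¹ * s)) * ‖T s‖
        ≤ Real.exp (-(t⁻¹ * s)) * (K * Real.exp (1 / (2 * t) * s)) := by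
          gcongr
          exact (hK s hs).trans (by gcongr)
      _ = K * (Real.exp (-(t⁻¹ * s)) * Real.exp (1 / (2 * t) * s)) := by ring
      _ = K * Real.exp (-(1 / (2 * t) * s)) := by
          rw [← Real.exp_add]
          congr 2
          field_simp
          ring

/-- Resolvent estimates on the line `Re lam = 1 / t` control `‖T(t)y‖` for `(x, y)` in the graph of
the generator. -/
theorem IsC0Semigroup.norm_orbit_le_of_resolvent_bound (hT : IsC0Semigroup T)
    (hK : ∀ s, 0 ≤ s → ‖T s‖ ≤ K * Real.exp (ω * s)) (hK0 : 0 < K) (hω : 0 ≤ ω) (ht : 0 < t)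
    (hωt : ω * t ≤ 1 / 2) {R : ℝ → H →L[ℂ] H} {m : ℕ} {C : ℝ}
    (hR : ∀ (ξ : ℝ) (x : H), R ξ x =
      ∫ s in Ioi (0 : ℝ), (Complex.exp (-(2 * Real.pi * ξ * Complex.I * s)) •
        Complex.exp (-(((t⁻¹ : ℝ) : ℂ) * s)) • T s) x)
    (hRg : ∀ (ξ : ℝ) (x : H), GeneratorGraph
      (fun s : ℝ => Complex.exp (-(2 * Real.pi * ξ * Complex.I * s)) •
        Complex.exp (-(((t⁻¹ : ℝ) : ℂ) * s)) • T s) (R ξ x) (-x))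
    (hC : ∀ ξ : ℝ, ‖((t⁻¹ : ℝ) : ℂ) + 2 * Real.pi * ξ * Complex.I‖ * ‖R ξ‖ ^ (m + 1)
      + ‖R ξ‖ ^ m ≤ C)
    {x y : H} (h : GeneratorGraph T x y) :
    ‖T t y‖ ≤ 2 * K ^ 2 * Real.exp 2 * (m + 1).factorial * 2 ^ (m + 1) *
      (C * t⁻¹ ^ (m + 1)) * ‖x‖ := by
  have hS := hT.isExpStable_rescale hK hK0.le ht hωt
  have hC0 : 0 ≤ C := le_trans (by positivity) (hC 0)
  have hmain := hS.eLpNorm_moment_le hR hRg hC (h.rescale _)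
  have hupper : eLpNorm ((Ioi (0 : ℝ)).indicator
      fun s : ℝ => (Complex.exp (-(((t⁻¹ : ℝ) : ℂ) * s)) • T s) x) 2 volume
      ≤ ENNReal.ofReal (K * ‖x‖) * ENNReal.ofReal (t ^ (1 / 2 : ℝ)) := by
    have h1 := eLpNorm_two_indicator_exp hS.rate_pos
    have h2 : 1 / (2 * (1 / (2 * t))) = t := by field_simp
    rw [h2] at h1
    rw [← h1]
    refine eLpNorm_le_mul_eLpNorm_of_ae_le_mul (Eventually.of_forall fun s => ?_) 2
    by_cases hs : s ∈ Ioi (0 : ℝ)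
    · simp only [indicator_of_mem hs, Real.norm_eq_abs, Real.abs_exp]
      refine (ContinuousLinearMap.le_of_opNorm_le _ (hS.norm_le s (le_of_lt hs)) x).trans
        (le_of_eq (by ring))
    · simp [indicator_of_notMem hs]
  set c : ℝ := (t / 2) ^ (m + 1) / (m + 1).factorial * Real.exp (-2) / K * ‖T t y‖ with hc
  have hc0 : 0 ≤ c := by positivity
  have hlower : ENNReal.ofReal c * ENNReal.ofReal ((t / 2) ^ (1 / 2 : ℝ)) ≤
      eLpNorm ((Ioi (0 : ℝ)).indicator fun s : ℝ => (s ^ (m + 1) / (m + 1).factorial : ℝ) •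
        (Complex.exp (-(((t⁻¹ : ℝ) : ℂ) * s)) • T s) y) 2 volume := by
    have h1 : eLpNorm ((Ioc (t / 2) t).indicator fun _ => c) 2 volume
        = ENNReal.ofReal c * ENNReal.ofReal ((t / 2) ^ (1 / 2 : ℝ)) := by
      rw [eLpNorm_indicator_const measurableSet_Ioc (by norm_num) (by norm_num),
        Real.enorm_eq_ofReal hc0, Real.volume_Ioc, sub_half, ENNReal.toReal_ofNat,
        ENNReal.ofReal_rpow_of_pos (by positivity)]
    rw [← h1]
    refine eLpNorm_mono fun s => ?_
    by_cases hs : s ∈ Ioc (t / 2) t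
    · have hs0 : 0 < s := lt_trans (by positivity) hs.1
      rw [indicator_of_mem hs, indicator_of_mem (Set.mem_Ioi.2 hs0), norm_smul, smul_apply,
        norm_smul, Real.norm_of_nonneg hc0, Real.norm_of_nonneg (by positivity), Complex.norm_exp,
        ← Complex.ofReal_mul, ← Complex.ofReal_neg, Complex.ofReal_re]
      have h2 : ‖T t y‖ ≤ K * Real.exp 1 * ‖T s y‖ := by
        have h3 := hT.map_add (t - s) s (by linarith [hs.2]) hs0.le
        rw [sub_add_cancel] at h3
        rw [h3]
        refine (T (t - s)).le_of_opNorm_le ?_ (T s y)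
        refine (hK _ (by linarith [hs.2])).trans ?_
        gcongr
        nlinarith [hs.1]
      have h4 : Real.exp (-1) ≤ Real.exp (-(t⁻¹ * s)) := by
        gcongr
        calc t⁻¹ * s ≤ t⁻¹ * t := by gcongr; exact hs.2
          _ = 1 := inv_mul_cancel₀ ht.ne'
      calc c ≤ (t / 2) ^ (m + 1) / (m + 1).factorial * Real.exp (-2) / K *
            (K * Real.exp 1 * ‖T s y‖) := by rw [hc]; gcongr
        _ = (t / 2) ^ (m + 1) / (m + 1).factorial *
            (Real.exp (-1) * ‖T s y‖) := by
            have : Real.exp (-1) = Real.exp (-2) * Real.exp 1 := by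
              rw [← Real.exp_add]; norm_num
            rw [this]
            field_simp
        _ ≤ _ := by
            gcongr
            exact hs.1.le
    · rw [indicator_of_notMem hs]
      simp
  have hfin := hlower.trans (hmain.trans (mul_le_mul_right hupper _))
  rw [← ENNReal.ofReal_mul hc0, ← ENNReal.ofReal_mul (by positivity), ← ENNReal.ofReal_mul hC0,
    ENNReal.ofReal_le_ofReal_iff (by positivity)] at hfin
  have hhalf : t ^ (1 / 2 : ℝ) ≤ 2 * (t / 2) ^ (1 / 2 : ℝ) := by
    have h1 : t ^ (1 / 2 : ℝ) = 2 ^ (1 / 2 : ℝ) * (t / 2) ^ (1 / 2 : ℝ) := by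
      rw [← Real.mul_rpow (by norm_num) (by positivity)]
      congr 1
      ring
    have h2 : (2 : ℝ) ^ (1 / 2 : ℝ) ≤ 2 := by
      simpa using Real.rpow_le_rpow_of_exponent_le (x := 2) (by norm_num)
        (show (1 / 2 : ℝ) ≤ 1 by norm_num)
    rw [h1]
    gcongr
  have hcle : c ≤ 2 * C * (K * ‖x‖) := by
    have h1 : 0 < (t / 2) ^ (1 / 2 : ℝ) := by positivity
    refine le_of_mul_le_mul_right (hfin.trans ?_) h1
    calc C * (K * ‖x‖ * t ^ (1 / 2 : ℝ)) ≤ C * (K * ‖x‖ * (2 * (t / 2) ^ (1 / 2 : ℝ))) := by gcongr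
      _ = _ := by ring
  calc ‖T t y‖ = c * (K * Real.exp 2 * (m + 1).factorial * 2 ^ (m + 1) * t⁻¹ ^ (m + 1)) := by
        rw [hc, Real.exp_neg, div_pow, inv_pow]
        field_simp
    _ ≤ 2 * C * (K * ‖x‖) *
        (K * Real.exp 2 * (m + 1).factorial * 2 ^ (m + 1) * t⁻¹ ^ (m + 1)) := by gcongr
    _ = _ := by ring

theorem mul_pow_add_pow_le_mul_rpow {β K M D t η r l : ℝ} {m : ℕ} (hβ0 : 0 < β) (hβ1 : β ≤ 1)
    (hm : 1 ≤ β * (m + 1)) (hK : 0 ≤ K) (hM : 0 ≤ M) (hD : 1 ≤ D) (ht : 0 < t) (ht1 : t ≤ 1)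
    (hr : 0 ≤ r) (hl : l ≤ t⁻¹ + |η|) (hrt : r ≤ 2 * K * t)
    (hrη : D * t ^ (-(1 / β)) ≤ |η| → r ≤ 2 * M * |η| ^ (-β)) :
    l * r ^ (m + 1) + r ^ m ≤
      ((2 * K) ^ m + (1 + D) * (2 * K) ^ (m + 1) + 2 * (2 * M) ^ (m + 1)) *
        (t ^ (m + 1) * t ^ (-(1 / β))) := by
  set p : ℝ := t ^ (-(1 / β)) with hp
  have hp0 : 0 < p := by positivity
  have htp : t⁻¹ ≤ p := by
    rw [hp, ← Real.rpow_neg_one]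
    apply Real.rpow_le_rpow_of_exponent_ge ht ht1
    have : 1 ≤ 1 / β := by rw [le_div_iff₀ hβ0]; linarith
    linarith
  have h1 : r ^ m ≤ (2 * K) ^ m * (t ^ (m + 1) * p) := by
    calc r ^ m ≤ (2 * K * t) ^ m := by gcongr
      _ = (2 * K) ^ m * (t ^ (m + 1) * t⁻¹) := by
        rw [mul_pow, pow_succ, mul_assoc, mul_inv_cancel₀ ht.ne', mul_one]
      _ ≤ _ := by gcongr
  rcases lt_or_ge |η| (D * p) with hη | hη
  · have h2 : l * r ^ (m + 1) ≤ (1 + D) * (2 * K) ^ (m + 1) * (t ^ (m + 1) * p) := by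
      calc l * r ^ (m + 1) ≤ ((1 + D) * p) * (2 * K * t) ^ (m + 1) := by
            gcongr
            linarith
        _ = _ := by rw [mul_pow]; ring
    have h3 : 0 ≤ 2 * (2 * M) ^ (m + 1) * (t ^ (m + 1) * p) := by positivity
    linarith
  · have hpη : p ≤ |η| := le_trans (le_mul_of_one_le_left hp0.le hD) hη
    have hη0 : 0 < |η| := hp0.trans_le hpη
    have h4 : |η| * (|η| ^ (-β)) ^ (m + 1) ≤ t ^ (m + 1) * p := by
      have h5 : ∀ z : ℝ, 0 < z → z * (z ^ (-β)) ^ (m + 1) = z ^ (1 - β * (m + 1)) := by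
        intro z hz
        rw [← Real.rpow_natCast, ← Real.rpow_mul hz.le, sub_eq_add_neg, Real.rpow_add hz,
          Real.rpow_one]
        push_cast
        congr 2
        ring
      have h6 : p ^ (-β) = t := by
        rw [hp, ← Real.rpow_mul ht.le, neg_mul_neg, one_div_mul_cancel hβ0.ne', Real.rpow_one]
      calc |η| * (|η| ^ (-β)) ^ (m + 1) = |η| ^ (1 - β * (m + 1)) := h5 _ hη0
        _ ≤ p ^ (1 - β * (m + 1)) := Real.rpow_le_rpow_of_nonpos hp0 hpη (by linarith)
        _ = t ^ (m + 1) * p := by rw [← h5 p hp0, h6, mul_comm]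
    have h2 : l * r ^ (m + 1) ≤ 2 * (2 * M) ^ (m + 1) * (t ^ (m + 1) * p) := by
      calc l * r ^ (m + 1) ≤ (2 * |η|) * (2 * M * |η| ^ (-β)) ^ (m + 1) := by
            gcongr
            · linarith
            · exact hrη hη
        _ = 2 * (2 * M) ^ (m + 1) * (|η| * (|η| ^ (-β)) ^ (m + 1)) := by rw [mul_pow]; ring
        _ ≤ _ := by gcongr
    have h3 : 0 ≤ (1 + D) * (2 * K) ^ (m + 1) * (t ^ (m + 1) * p) := by positivity
    linarith

/-- Resolvent decay `|η|^{-β}` gives `‖T(t) A x‖ ≤ C t^{-1/β} ‖x‖` for `x` in the domain. -/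
theorem IsGenerator.exists_norm_orbit_le {A : H →ₗ.[ℂ] H} {β M R₀ : ℝ} (hT : IsC0Semigroup T)
    (hgen : IsGenerator T A) (hβ0 : 0 < β) (hβ1 : β ≤ 1) (hM : 0 < M)
    (hres : ∀ η : ℝ, R₀ ≤ |η| →
      ∃ Rop : H →L[ℂ] H, IsResolventAt A (Complex.I * η) Rop ∧ ‖Rop‖ ≤ M * |η| ^ (-β)) :
    ∃ C t₀ : ℝ, 0 < C ∧ 0 < t₀ ∧ ∀ t, 0 < t → t ≤ t₀ → ∀ x y : H, GeneratorGraph T x y →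
      ‖T t y‖ ≤ C * t ^ (-(1 / β)) * ‖x‖ := by
  obtain ⟨K, ω, hK1, hω, hK⟩ := hT.exists_norm_le_exp
  have hK0 : 0 < K := by linarith
  obtain ⟨m, hm⟩ := exists_nat_ge (1 / β)
  have hm' : 1 ≤ β * ((m : ℝ) + 1) := by
    rw [div_le_iff₀ hβ0] at hm
    nlinarith
  set D : ℝ := max 1 (max R₀ ((2 * M) ^ (1 / β))) with hD
  have hD1 : 1 ≤ D := le_max_left _ _
  have hDR : R₀ ≤ D := (le_max_left _ _).trans (le_max_right _ _)
  have hDM : (2 * M) ^ (1 / β) ≤ D := (le_max_right _ _).trans (le_max_right _ _)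
  set C₁ : ℝ := (2 * K) ^ m + (1 + D) * (2 * K) ^ (m + 1) + 2 * (2 * M) ^ (m + 1) with hC₁
  set C₂ : ℝ := 2 * K ^ 2 * Real.exp 2 * (m + 1).factorial * 2 ^ (m + 1) with hC₂
  refine ⟨C₂ * C₁, min 1 (1 / (2 * (ω + 1))), by positivity, by positivity,
    fun t ht htt x y hxy => ?_⟩
  have ht1 : t ≤ 1 := htt.trans (min_le_left _ _)
  have hωt : ω * t ≤ 1 / 2 := by
    have h1 : t ≤ 1 / (2 * (ω + 1)) := htt.trans (min_le_right _ _)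
    rw [le_div_iff₀ (by positivity)] at h1
    nlinarith
  have hS := hT.isExpStable_rescale hK hK0.le ht hωt
  choose R hR hRn hRg using fun ξ : ℝ =>
    (hS.rescale (c := 2 * Real.pi * ξ * Complex.I) (by simp)).exists_inverse
  have hp1 : 1 ≤ t ^ (-(1 / β)) := Real.one_le_rpow_of_pos_of_le_one_of_nonpos ht ht1 (by
    have : 0 < 1 / β := by positivity
    linarith)
  have hbound : ∀ ξ : ℝ, ‖((t⁻¹ : ℝ) : ℂ) + 2 * Real.pi * ξ * Complex.I‖ * ‖R ξ‖ ^ (m + 1)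
      + ‖R ξ‖ ^ m ≤ C₁ * (t ^ (m + 1) * t ^ (-(1 / β))) := by
    intro ξ
    have hcast : (2 * Real.pi * ξ * Complex.I : ℂ) = Complex.I * ((2 * Real.pi * ξ : ℝ) : ℂ) := by
      push_cast
      ring
    refine mul_pow_add_pow_le_mul_rpow (η := 2 * Real.pi * ξ) hβ0 hβ1 hm' hK0.le hM.le hD1 ht ht1
      (norm_nonneg _) ?_ ?_ fun hη => ?_
    · refine (norm_add_le _ _).trans (le_of_eq ?_)
      rw [hcast, norm_mul, Complex.norm_I, one_mul, Complex.norm_real, Complex.norm_real,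
        Real.norm_of_nonneg (by positivity), Real.norm_eq_abs]
    · refine (hRn ξ).trans (le_of_eq ?_)
      field_simp
    · have hDη : D ≤ |2 * Real.pi * ξ| := le_trans (le_mul_of_one_le_right (by linarith) hp1) hη
      obtain ⟨Q, hQ, hQn⟩ := hres (2 * Real.pi * ξ) (hDR.trans hDη)
      have hη0 : 0 < |2 * Real.pi * ξ| := by linarith
      have hsmall : t⁻¹ * ‖Q‖ ≤ 1 / 2 := by
        have h1 : 2 * M * t⁻¹ ≤ |2 * Real.pi * ξ| ^ β := by
          calc 2 * M * t⁻¹ = ((2 * M) ^ (1 / β) * t ^ (-(1 / β))) ^ β := by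
                rw [Real.mul_rpow (by positivity) (by positivity), ← Real.rpow_mul (by positivity),
                  ← Real.rpow_mul ht.le, neg_mul, one_div_mul_cancel hβ0.ne', Real.rpow_one,
                  Real.rpow_neg_one]
            _ ≤ |2 * Real.pi * ξ| ^ β := by
                gcongr
                refine le_trans ?_ hη
                gcongr
        calc t⁻¹ * ‖Q‖ ≤ t⁻¹ * (M * |2 * Real.pi * ξ| ^ (-β)) := by gcongr
          _ = 2 * M * t⁻¹ / 2 / |2 * Real.pi * ξ| ^ β := by
              rw [Real.rpow_neg hη0.le]
              ring
          _ ≤ 1 / 2 := by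
              rw [div_le_iff₀ (by positivity)]
              linarith
      have h2 := hQ.norm_le_two_mul hgen (by positivity : 0 ≤ t⁻¹) (R := R ξ) (fun x => by
        rw [← hcast]
        exact (hRg ξ x).of_rescale.of_rescale) hsmall
      linarith
  have h1 := hT.norm_orbit_le_of_resolvent_bound hK hK0 hω ht hωt hR hRg hbound hxy
  refine h1.trans (le_of_eq ?_)
  rw [inv_pow, ← hC₂]
  field_simp

end Smoothing

/-- If `‖T(t) A x‖ ≤ C ‖x‖` on the domain of `A`, then `A T(t)` is bounded by `C`. -/
theorem IsGenerator.exists_apply_orbit_norm_le [CompleteSpace H] {T : ℝ → H →L[ℂ] H}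
    {A : H →ₗ.[ℂ] H} (hT : IsC0Semigroup T) (hgen : IsGenerator T A) {t C : ℝ} (ht : 0 ≤ t)
    (h : ∀ x y : H, GeneratorGraph T x y → ‖T t y‖ ≤ C * ‖x‖) (x : H) :
    ∃ hx : T t x ∈ A.domain, ‖A ⟨T t x, hx⟩‖ ≤ C * ‖x‖ := by
  obtain ⟨u, v, huv, hu⟩ := hT.exists_seq_graph x
  have hcauchy : CauchySeq fun n => T t (v n) := by
    have h1 : Tendsto (fun p : ℕ × ℕ => C * ‖u p.1 - u p.2‖) atTop (𝓝 0) := by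
      have h2 := (cauchySeq_iff_tendsto_dist_atTop_0.1 hu.cauchySeq).const_mul C
      simpa [dist_eq_norm] using h2
    rw [cauchySeq_iff_tendsto_dist_atTop_0]
    refine squeeze_zero (fun _ => dist_nonneg) (fun p => ?_) h1
    rw [dist_eq_norm, ← map_sub]
    exact h _ _ ((huv p.1).sub (huv p.2))
  obtain ⟨w, hw⟩ := cauchySeq_tendsto_of_complete hcauchy
  have hg : GeneratorGraph T (T t x) w :=
    hT.graph_closed (fun n => hT.graph_orbit (huv n) ht)
      (((T t).continuous.tendsto x).comp hu) hw
  obtain ⟨hx, hA⟩ := (hgen.graph_iff (y := -w)).1 (by simpa using hg)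
  refine ⟨hx, ?_⟩
  rw [hA, norm_neg]
  exact le_of_tendsto_of_tendsto' hw.norm (hu.norm.const_mul C) fun n => h _ _ (huv n)

/-- Resolvent decay `|η|^{-β}` on the imaginary axis implies the Crandall–Pazy condition. -/
theorem IsGenerator.inCrandallPazy_of_resolvent_bound [CompleteSpace H] {T : ℝ → H →L[ℂ] H}
    {A : H →ₗ.[ℂ] H} {β M R₀ : ℝ} (hT : IsC0Semigroup T) (hgen : IsGenerator T A) (hβ0 : 0 < β)
    (hβ1 : β ≤ 1) (hM : 0 < M)
    (hres : ∀ η : ℝ, R₀ ≤ |η| →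
      ∃ Rop : H →L[ℂ] H, IsResolventAt A (Complex.I * η) Rop ∧ ‖Rop‖ ≤ M * |η| ^ (-β)) :
    InCrandallPazy T A β := by
  obtain ⟨C, t₀, hC, ht₀, hbd⟩ := hgen.exists_norm_orbit_le hT hβ0 hβ1 hM hres
  have hsmall : ∀ t, 0 < t → t ≤ t₀ → ∀ x, ∃ hx : T t x ∈ A.domain,
      ‖A ⟨T t x, hx⟩‖ ≤ C * t ^ (-(1 / β)) * ‖x‖ := fun t ht htt =>
    hgen.exists_apply_orbit_norm_le hT ht.le (hbd t ht htt)
  have hop : ∀ t, 0 < t → t ≤ t₀ → ∃ B : H →L[ℂ] H,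
      (∀ x, ∃ hx : T t x ∈ A.domain, B x = A ⟨T t x, hx⟩) ∧ ‖B‖ ≤ C * t ^ (-(1 / β)) := by
    intro t ht htt
    choose hdom hnorm using hsmall t ht htt
    let L : H →ₗ[ℂ] H := A.toFun ∘ₗ (T t).toLinearMap.codRestrict A.domain hdom
    exact ⟨L.mkContinuous _ hnorm, fun x => ⟨hdom x, rfl⟩,
      L.mkContinuous_norm_le (by positivity) _⟩
  have hall : ∀ t : ℝ, ∃ B : H →L[ℂ] H, (0 < t →
      ∀ x, ∃ hx : T t x ∈ A.domain, B x = A ⟨T t x, hx⟩) ∧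
      (0 < t → t ≤ t₀ → ‖B‖ ≤ C * t ^ (-(1 / β))) := by
    intro t
    rcases le_or_gt t 0 with ht | ht
    · exact ⟨0, fun h => absurd h ht.not_gt, fun h => absurd h ht.not_gt⟩
    rcases le_or_gt t t₀ with htt | htt
    · obtain ⟨B, hB, hBn⟩ := hop t ht htt
      exact ⟨B, fun _ => hB, fun _ _ => hBn⟩
    · obtain ⟨B, hB, -⟩ := hop t₀ ht₀ le_rfl
      refine ⟨B ∘L T (t - t₀), fun _ x => ?_, fun _ h => absurd h htt.not_ge⟩
      have h1 := hT.map_add t₀ (t - t₀) ht₀.le (by linarith)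
      rw [add_sub_cancel] at h1
      rw [h1]
      exact hB (T (t - t₀) x)
  choose B hB hBn using hall
  exact ⟨B, hB, C, t₀, hC, ht₀, hBn⟩

/-- Theorem 2.4 (i) ⇔ (ii): for the generator `-A` of a `C₀`-semigroup on a Hilbert space
and `β ∈ (0,1]`, the semigroup is in the Crandall–Pazy class with parameter `β` iff
`σ(A) ∩ iℝ` is bounded and `‖(iη + A)⁻¹‖ ≤ M |η|^{-β}` for `|η| ≥ R`. -/
theorem crandallPazy_iff_resolvent_bound
    {H : Type*} [NormedAddCommGroup H] [InnerProductSpace ℂ H] [CompleteSpace H]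
    (T : ℝ → H →L[ℂ] H) (A : H →ₗ.[ℂ] H)
    (hT : IsC0Semigroup T) (hgen : IsGenerator T A)
    (β : ℝ) (hβ0 : 0 < β) (hβ1 : β ≤ 1) :
    InCrandallPazy T A β ↔
      ((∃ R₀ : ℝ, 0 < R₀ ∧ ∀ η : ℝ, R₀ ≤ |η| →
          ∃ Rop : H →L[ℂ] H, IsResolventAt A (Complex.I * η) Rop) ∧
        ∃ M R : ℝ, 0 < M ∧ 0 < R ∧ ∀ η : ℝ, R ≤ |η| →
          ∃ Rop : H →L[ℂ] H, IsResolventAt A (Complex.I * η) Rop ∧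
            ‖Rop‖ ≤ M * |η| ^ (-β)) := by
  constructor
  · intro h
    obtain ⟨M, R, hM, hR, hres⟩ := h.exists_resolvent_bound hT hgen hβ0 hβ1
    exact ⟨⟨R, hR, fun η hη => (hres η hη).imp fun _ hRop => hRop.1⟩, M, R, hM, hR, hres⟩
  · rintro ⟨-, M, R, hM, -, hres⟩
    exact hgen.inCrandallPazy_of_resolvent_bound hT hβ0 hβ1 hM hres

end
end

section
/- Let −A be the generator of an exponentially stable C₀-semigroup (e^{-tA})_{t≥0} on a complex Hilbert space H that is in the Crandall–Pazy class with parameter β ∈ (0,1]. Then for every positive integer α, every ε > 0, and every pair 0 < ω_min ≤ ω_max < ∞, there exists a constant M > 0 such that ‖(∏_{k=1}^n V_{ω_k}(A)) A^{-α}‖ ≤ M (log(n+1))^{2α/(2−β)+ε} · n^{-α/(2−β)} for all n ∈ ℕ and all (ω_k)_{k∈ℕ} ∈ S(ω_min, ω_max). -/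
open Filter Topology

noncomputable section

variable {H : Type*} [NormedAddCommGroup H] [InnerProductSpace ℂ H]

/-- The semigroup `T` is exponentially stable. -/
def IsExpStable (T : ℝ → H →L[ℂ] H) : Prop :=
  ∃ K c : ℝ, 0 < K ∧ 0 < c ∧ ∀ t : ℝ, 0 ≤ t → ‖T t‖ ≤ K * Real.exp (-(c * t))

/-- Abstract data of an exponentially stable semigroup `T` (restricted to positive times), its
real resolvents `R lam = (lam + A)⁻¹`, and the smoothing estimate
`‖A T t (lam + A)⁻¹‖ ≤ L / (1 + (lam + 1) ^ β t)`. The list is invariant under taking adjoints. -/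
structure IsResolventFamily (T R : ℝ → H →L[ℂ] H) (K c L β : ℝ) : Prop where
  K_nonneg : 0 ≤ K
  c_pos : 0 < c
  c_le_one : c ≤ 1
  commute_semigroup : ∀ t lam, 0 < t → 0 ≤ lam → Commute (T t) (R lam)
  commute_resolvent : ∀ lam mu, 0 ≤ lam → 0 ≤ mu → Commute (R lam) (R mu)
  resolvent_sub : ∀ lam mu, 0 ≤ lam → 0 ≤ mu → R lam - R mu = (mu - lam) • (R lam * R mu)
  hasDerivAt : ∀ lam t, 0 ≤ lam → 0 < t →
    HasDerivAt (fun u => T u * R lam) (lam • (T t * R lam) - T t) t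
  tendsto_zero : ∀ lam, 0 ≤ lam → Tendsto (fun t => T t * R lam) (𝓝[>] 0) (𝓝 (R lam))
  norm_semigroup_le : ∀ t, 0 < t → ‖T t‖ ≤ K * Real.exp (-(c * t))
  norm_resolvent_le : ∀ lam, 0 ≤ lam → ‖R lam‖ ≤ K / (c + lam)
  norm_smoothing_le : ∀ t lam, 0 < t → 0 ≤ lam →
    ‖T t * (1 - lam • R lam)‖ ≤ L / (1 + (lam + 1) ^ β * t)

/-- The Cayley transform with parameter `w` of the shifted operator `s + A`. -/
def shiftedCayley (R : ℝ → H →L[ℂ] H) (s w : ℝ) : H →L[ℂ] H := 1 - (2 * w) • R (s + w)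

/-- The product of the first `n` Cayley transforms of `s + A` with parameters `ω k`. -/
def cayleyProd (R : ℝ → H →L[ℂ] H) (s : ℝ) (ω : ℕ → ℝ) (n : ℕ) : H →L[ℂ] H :=
  ((List.range n).map fun k => shiftedCayley R s (ω k)).prod

@[simp] lemma cayleyProd_zero (R : ℝ → H →L[ℂ] H) (s : ℝ) (ω : ℕ → ℝ) :
    cayleyProd R s ω 0 = 1 := by
  simp [cayleyProd]

lemma cayleyProd_succ (R : ℝ → H →L[ℂ] H) (s : ℝ) (ω : ℕ → ℝ) (n : ℕ) :
    cayleyProd R s ω (n + 1) = cayleyProd R s ω n * shiftedCayley R s (ω n) := by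
  simp [cayleyProd, List.range_succ]

lemma cayleyProd_add (R : ℝ → H →L[ℂ] H) (s : ℝ) (ω : ℕ → ℝ) (m n : ℕ) :
    cayleyProd R s ω (m + n) = cayleyProd R s ω m * cayleyProd R s (fun k => ω (m + k)) n := by
  induction n with
  | zero => simp
  | succ n ih => rw [← add_assoc, cayleyProd_succ, ih, cayleyProd_succ, mul_assoc]

lemma commute_cayleyProd {R : ℝ → H →L[ℂ] H} {s : ℝ} {ω : ℕ → ℝ} {Z : H →L[ℂ] H}
    (hZ : ∀ k, Commute Z (R (s + ω k))) (n : ℕ) : Commute Z (cayleyProd R s ω n) := by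
  induction n with
  | zero => simp
  | succ n ih =>
    rw [cayleyProd_succ]
    exact ih.mul_right ((Commute.one_right Z).sub_right ((hZ n).smul_right _))

namespace IsResolventFamily

variable {T R : ℝ → H →L[ℂ] H} {K c L β : ℝ}

lemma commute_resolvent_cayleyProd (h : IsResolventFamily T R K c L β) {s lam : ℝ} (hs : 0 ≤ s)
    (hlam : 0 ≤ lam) {ω : ℕ → ℝ} (hω : ∀ k, 0 < ω k) (n : ℕ) :
    Commute (R lam) (cayleyProd R s ω n) :=
  commute_cayleyProd (fun k => h.commute_resolvent _ _ hlam (by linarith [hω k])) n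

lemma commute_cayley_cayleyProd (h : IsResolventFamily T R K c L β) {s s' w : ℝ} (hs : 0 ≤ s)
    (hs' : 0 ≤ s') (hw : 0 < w) {ω : ℕ → ℝ} (hω : ∀ k, 0 < ω k) (n : ℕ) :
    Commute (shiftedCayley R s' w) (cayleyProd R s ω n) :=
  (Commute.one_left _).sub_left
    ((h.commute_resolvent_cayleyProd hs (by linarith) hω n).smul_left _)

/-- The adjoint family. -/
lemma adjoint [CompleteSpace H] (h : IsResolventFamily T R K c L β) :
    IsResolventFamily (fun t => star (T t)) (fun lam => star (R lam)) K c L β where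
  K_nonneg := h.K_nonneg
  c_pos := h.c_pos
  c_le_one := h.c_le_one
  commute_semigroup t lam ht hlam := (h.commute_semigroup t lam ht hlam).star_star
  commute_resolvent lam mu hlam hmu := (h.commute_resolvent lam mu hlam hmu).star_star
  resolvent_sub lam mu hlam hmu := by
    rw [← star_sub, h.resolvent_sub lam mu hlam hmu, star_smul, ← star_mul,
      (h.commute_resolvent lam mu hlam hmu).eq, star_trivial]
  hasDerivAt lam t hlam ht := by
    have h1 := (h.hasDerivAt lam t hlam ht).star
    have h2 : ∀ u, 0 < u → star (T u) * star (R lam) = star (T u * R lam) := fun u hu => by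
      rw [← star_mul, (h.commute_semigroup u lam hu hlam).eq]
    rw [star_sub, star_smul, ← h2 t ht, star_trivial] at h1
    refine h1.congr_of_eventuallyEq ?_
    filter_upwards [lt_mem_nhds ht] with u hu using h2 u hu
  tendsto_zero lam hlam := by
    refine ((continuous_star.tendsto _).comp (h.tendsto_zero lam hlam)).congr' ?_
    filter_upwards [self_mem_nhdsWithin] with t ht
    simp only [Function.comp]
    rw [(h.commute_semigroup t lam ht hlam).eq, star_mul]
  norm_semigroup_le t ht := by simpa using h.norm_semigroup_le t ht
  norm_resolvent_le lam hlam := by simpa using h.norm_resolvent_le lam hlam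
  norm_smoothing_le t lam ht hlam := by
    have h1 : star (T t) * (1 - lam • star (R lam)) = star (T t * (1 - lam • R lam)) := by
      rw [((Commute.one_right (T t)).sub_right
        ((h.commute_semigroup t lam ht hlam).smul_right lam)).eq, star_mul]
      simp
    rw [h1, norm_star]
    exact h.norm_smoothing_le t lam ht hlam

lemma star_cayleyProd [CompleteSpace H] (h : IsResolventFamily T R K c L β) {s : ℝ} (hs : 0 ≤ s)
    {ω : ℕ → ℝ} (hω : ∀ k, 0 < ω k) (n : ℕ) :
    star (cayleyProd R s ω n) = cayleyProd (fun lam => star (R lam)) s ω n := by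
  induction n with
  | zero => simp
  | succ n ih =>
    rw [cayleyProd_succ, ← (h.commute_cayley_cayleyProd hs hs (hω n) hω n).eq, star_mul, ih,
      cayleyProd_succ]
    simp [shiftedCayley]

/-- Derivative of the squared orbit of the shifted semigroup through a resolvent vector. -/
lemma hasDerivAt_norm_sq (h : IsResolventFamily T R K c L β) {s w t : ℝ} (hs : 0 ≤ s)
    (hw : 0 < w) (ht : 0 < t) (x : H) :
    HasDerivAt (fun u => 2 * w * ‖Real.exp (-(s * u)) • T u (R (s + w) x)‖ ^ 2)
      (‖Real.exp (-(s * t)) • T t (shiftedCayley R s w x)‖ ^ 2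
        - ‖Real.exp (-(s * t)) • T t x‖ ^ 2) t := by
  have h1 : HasDerivAt (fun u => T u (R (s + w) x))
      ((s + w) • T t (R (s + w) x) - T t x) t :=
    ((ContinuousLinearMap.apply ℂ H x).restrictScalars ℝ).hasFDerivAt.comp_hasDerivAt t
      (h.hasDerivAt (s + w) t (by linarith) ht)
  have h2 : HasDerivAt (fun u : ℝ => Real.exp (-(s * u))) (Real.exp (-(s * t)) * (-s)) t := by
    have := ((hasDerivAt_id t).const_mul s).neg.exp
    simpa using this
  let _ : InnerProductSpace ℝ H := InnerProductSpace.complexToReal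
  have h3 := (h2.fun_smul h1).norm_sq.const_mul (2 * w)
  refine h3.congr_deriv ?_
  set e := Real.exp (-(s * t))
  set y := T t (R (s + w) x)
  set v := T t x
  have e1 : T t (shiftedCayley R s w x) = v - (2 * w) • y := by
    simp [shiftedCayley, y, v]
  have e2 : e • ((s + w) • y - v) + (e * -s) • y = w • (e • y) - e • v := by
    module
  rw [e1, e2, smul_sub, smul_comm e (2 * w) y]
  generalize e • y = a
  generalize e • v = b
  rw [norm_sub_sq_real, inner_sub_right, norm_smul, inner_smul_right, inner_smul_right,
    real_inner_self_eq_norm_sq, real_inner_comm a b, mul_pow, Real.norm_eq_abs, sq_abs]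
  ring

/-- A Lyapunov-type square function estimate along the Cayley iteration. -/
lemma sum_norm_sq_le (h : IsResolventFamily T R K c L β) {s : ℝ} (hs : 0 ≤ s)
    {ω : ℕ → ℝ} (hω : ∀ k, 0 < ω k) (n : ℕ) (x : H) {Γ Γ' : ℝ → ℝ} {G : ℝ}
    (hΓ : ∀ t, 0 < t → HasDerivAt Γ (Γ' t) t) (hpos : ∀ t, 0 < t → 0 ≤ Γ t)
    (hG : ∀ t, 0 < t → Γ t ≤ G)
    (hx : ∀ t, 0 < t → ‖Real.exp (-(s * t)) • T t x‖ ^ 2 ≤ -Γ' t) :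
    ∑ k ∈ Finset.range n, 2 * ω k * ‖R (s + ω k) (cayleyProd R s ω k x)‖ ^ 2 ≤ G := by
  set X : ℕ → H := fun k => cayleyProd R s ω k x
  set Φ : ℝ → ℝ := fun t =>
    ∑ k ∈ Finset.range n, 2 * ω k * ‖Real.exp (-(s * t)) • T t (R (s + ω k) (X k))‖ ^ 2
  have hX : ∀ k, X (k + 1) = shiftedCayley R s (ω k) (X k) := fun k => by
    simp only [X]
    rw [cayleyProd_succ, ← (h.commute_cayley_cayleyProd hs hs (hω k) hω k).eq]
    rfl
  have hΦ : ∀ t, 0 < t → HasDerivAt Φ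
      (‖Real.exp (-(s * t)) • T t (X n)‖ ^ 2 - ‖Real.exp (-(s * t)) • T t x‖ ^ 2) t := by
    intro t ht
    have h1 := HasDerivAt.fun_sum (u := Finset.range n)
      (fun k _ => h.hasDerivAt_norm_sq hs (hω k) ht (X k))
    refine h1.congr_deriv ?_
    simp_rw [← hX]
    rw [Finset.sum_range_sub (fun k => ‖Real.exp (-(s * t)) • T t (X k)‖ ^ 2)]
    simp [X]
  have hmono : MonotoneOn (fun t => Φ t - Γ t) (Set.Ioi 0) := by
    refine monotoneOn_of_deriv_nonneg (convex_Ioi 0)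
      (fun t ht => ((hΦ t ht).sub (hΓ t ht)).continuousAt.continuousWithinAt)
      (fun t ht => ?_) (fun t ht => ?_)
    · rw [interior_Ioi] at ht
      exact ((hΦ t ht).sub (hΓ t ht)).differentiableAt.differentiableWithinAt
    · rw [interior_Ioi] at ht
      rw [((hΦ t ht).fun_sub (hΓ t ht)).deriv]
      nlinarith [hx t ht, sq_nonneg ‖Real.exp (-(s * t)) • T t (X n)‖]
  have hterm : ∀ y : H, Tendsto (fun t => ‖Real.exp (-(s * t)) • T t y‖) atTop (𝓝 0) := by
    intro y
    have hlim : Tendsto (fun t : ℝ => K * Real.exp (-(c * t)) * ‖y‖) atTop (𝓝 0) := by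
      have : Tendsto (fun t : ℝ => Real.exp (-(c * t))) atTop (𝓝 0) :=
        Real.tendsto_exp_neg_atTop_nhds_zero.comp (tendsto_id.const_mul_atTop h.c_pos)
      simpa using (this.const_mul K).mul_const ‖y‖
    refine squeeze_zero' (Eventually.of_forall fun t => norm_nonneg _) ?_ hlim
    filter_upwards [eventually_gt_atTop 0] with t ht
    rw [norm_smul, Real.norm_eq_abs, abs_of_pos (Real.exp_pos _)]
    have h1 : Real.exp (-(s * t)) ≤ 1 := Real.exp_le_one_iff.2 (by nlinarith)
    have h2 : ‖T t y‖ ≤ K * Real.exp (-(c * t)) * ‖y‖ :=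
      (T t).le_of_opNorm_le (h.norm_semigroup_le t ht) y
    nlinarith [norm_nonneg (T t y), Real.exp_pos (-(s * t))]
  have hΦtop : Tendsto Φ atTop (𝓝 0) := by
    have := tendsto_finsetSum (Finset.range n)
      (fun k _ => ((hterm (R (s + ω k) (X k))).pow 2).const_mul (2 * ω k))
    simpa using this
  have hΦle : ∀ t, 0 < t → Φ t ≤ G := by
    intro t ht
    have : Φ t - Γ t ≤ 0 := by
      refine ge_of_tendsto hΦtop ?_
      filter_upwards [eventually_ge_atTop t] with u hu
      have hu0 : 0 < u := ht.trans_le hu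
      have := hmono (Set.mem_Ioi.2 ht) (Set.mem_Ioi.2 hu0) hu
      simp only at this
      linarith [hpos u hu0]
    linarith [hG t ht]
  have hΦzero : Tendsto Φ (𝓝[>] 0)
      (𝓝 (∑ k ∈ Finset.range n, 2 * ω k * ‖R (s + ω k) (X k)‖ ^ 2)) := by
    refine tendsto_finsetSum _ fun k _ => ?_
    have h1 : Tendsto (fun t => T t (R (s + ω k) (X k))) (𝓝[>] 0) (𝓝 (R (s + ω k) (X k))) :=
      ((ContinuousLinearMap.apply ℂ H (X k)).continuous.tendsto _).comp
        (h.tendsto_zero (s + ω k) (by linarith [hω k]))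
    have h2 : Tendsto (fun t : ℝ => Real.exp (-(s * t))) (𝓝[>] 0) (𝓝 1) := by
      have : Continuous fun t : ℝ => Real.exp (-(s * t)) := by fun_prop
      simpa using (this.tendsto 0).mono_left nhdsWithin_le_nhds
    simpa using ((h2.smul h1).norm.pow 2).const_mul (2 * ω k)
  refine le_of_tendsto hΦzero ?_
  filter_upwards [self_mem_nhdsWithin] with t ht using hΦle t ht

lemma sum_norm_sq_shifted_le (h : IsResolventFamily T R K c L β) {s : ℝ} (hs : 0 ≤ s)
    {ω : ℕ → ℝ} (hω : ∀ k, 0 < ω k) (n : ℕ) (x : H) :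
    ∑ k ∈ Finset.range n, 2 * ω k * ‖R (s + ω k) (cayleyProd R s ω k x)‖ ^ 2
      ≤ K ^ 2 / (2 * (c + s)) * ‖x‖ ^ 2 := by
  have hcs : 0 < c + s := by linarith [h.c_pos]
  have hK := h.K_nonneg
  refine h.sum_norm_sq_le hs hω n x
    (Γ := fun t => K ^ 2 / (2 * (c + s)) * ‖x‖ ^ 2 * Real.exp (-(2 * (c + s) * t)))
    (Γ' := fun t => -((K * Real.exp (-(c * t)) * Real.exp (-(s * t)) * ‖x‖) ^ 2)) ?_ ?_ ?_ ?_
  · intro t _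
    have h1 : HasDerivAt (fun t : ℝ => Real.exp (-(2 * (c + s) * t)))
        (Real.exp (-(2 * (c + s) * t)) * (-(2 * (c + s)))) t := by
      simpa using ((hasDerivAt_id t).const_mul (2 * (c + s))).neg.exp
    refine (h1.const_mul _).congr_deriv ?_
    have e1 : Real.exp (-(2 * (c + s) * t)) = (Real.exp (-(c * t)) * Real.exp (-(s * t))) ^ 2 := by
      rw [← Real.exp_add, sq, ← Real.exp_add]
      ring_nf
    rw [e1]
    field_simp
  · intro t _
    positivity
  · intro t ht
    have : Real.exp (-(2 * (c + s) * t)) ≤ 1 := Real.exp_le_one_iff.2 (by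
      have := mul_pos hcs ht
      nlinarith)
    exact mul_le_of_le_one_right (by positivity) this
  · intro t ht
    rw [neg_neg]
    refine pow_le_pow_left₀ (norm_nonneg _) ?_ 2
    rw [norm_smul, Real.norm_eq_abs, abs_of_pos (Real.exp_pos _)]
    have h2 : ‖T t x‖ ≤ K * Real.exp (-(c * t)) * ‖x‖ :=
      (T t).le_of_opNorm_le (h.norm_semigroup_le t ht) x
    calc _ ≤ Real.exp (-(s * t)) * (K * Real.exp (-(c * t)) * ‖x‖) := by gcongr
      _ = _ := by ring

lemma sum_norm_sq_smoothing_le (h : IsResolventFamily T R K c L β)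
    {ω : ℕ → ℝ} (hω : ∀ k, 0 < ω k) (n : ℕ) {lam : ℝ} (hlam : 0 ≤ lam) (x : H) :
    ∑ k ∈ Finset.range n,
        2 * ω k * ‖R (ω k) (cayleyProd R 0 ω k ((1 - lam • R lam) x))‖ ^ 2
      ≤ L ^ 2 * (lam + 1) ^ (-β) * ‖x‖ ^ 2 := by
  have hr : 0 < (lam + 1) ^ β := Real.rpow_pos_of_pos (by linarith) _
  rw [Real.rpow_neg (by linarith)]
  set r := (lam + 1) ^ β with hrdef
  have hden : ∀ t : ℝ, 0 < t → 0 < 1 + r * t := fun t ht => by positivity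
  have key := h.sum_norm_sq_le le_rfl hω n ((1 - lam • R lam) x)
    (Γ := fun t => L ^ 2 * r⁻¹ * ‖x‖ ^ 2 * (1 + r * t)⁻¹)
    (Γ' := fun t => -((L / (1 + r * t) * ‖x‖) ^ 2)) (G := L ^ 2 * r⁻¹ * ‖x‖ ^ 2) ?_ ?_ ?_ ?_
  · simpa using key
  · intro t ht
    have h1 : HasDerivAt (fun t : ℝ => 1 + r * t) r t := by
      simpa using ((hasDerivAt_id t).const_mul r).const_add 1
    refine ((h1.inv (hden t ht).ne').const_mul _).congr_deriv ?_
    have := (hden t ht).ne'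
    field_simp
  · intro t ht
    have := hden t ht
    positivity
  · intro t ht
    exact mul_le_of_le_one_right (by positivity) (inv_le_one_of_one_le₀ (by nlinarith [mul_pos hr ht]))
  · intro t ht
    rw [neg_neg]
    refine pow_le_pow_left₀ (norm_nonneg _) ?_ 2
    simp only [zero_mul, neg_zero, Real.exp_zero, one_smul]
    exact (T t * (1 - lam • R lam)).le_of_opNorm_le (h.norm_smoothing_le t lam ht hlam) x

/-- Exchanging the shift in a Cayley product costs a controlled amount. The parameters of the
comparison product come in reversed order. -/
lemma cayleyProd_sub_cayleyProd_reverse (h : IsResolventFamily T R K c L β) {s s' : ℝ}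
    (hs : 0 ≤ s) (hs' : 0 ≤ s') {ω : ℕ → ℝ} (hω : ∀ k, 0 < ω k) {n m : ℕ} (hm : m ≤ n) :
    cayleyProd R s ω m * cayleyProd R s' (fun i => ω (n - 1 - i)) (n - m)
      - cayleyProd R s' (fun i => ω (n - 1 - i)) n
      = (s - s') • ∑ k ∈ Finset.range m, (2 * ω k) •
        ((cayleyProd R s ω k * R (s + ω k)) *
          (R (s' + ω k) * cayleyProd R s' (fun i => ω (n - 1 - i)) (n - 1 - k))) := by
  induction m with
  | zero => simp
  | succ m ih =>
    rw [Finset.sum_range_succ, smul_add, ← ih (by omega)]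
    have e1 : n - m = (n - 1 - m) + 1 := by omega
    have e2 : n - (m + 1) = n - 1 - m := by omega
    have e3 : n - 1 - (n - 1 - m) = m := by omega
    rw [e1, e2, cayleyProd_succ, cayleyProd_succ, e3,
      ← (h.commute_cayley_cayleyProd (ω := fun i => ω (n - 1 - i)) hs' hs' (hω m)
        (fun i => hω _) (n - 1 - m)).eq]
    generalize cayleyProd R s' (fun i => ω (n - 1 - i)) (n - 1 - m) = P'
    generalize cayleyProd R s ω m = P
    have e4 : shiftedCayley R s (ω m) = shiftedCayley R s' (ω m)
        + (s - s') • (2 * ω m) • (R (s + ω m) * R (s' + ω m)) := by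
      have := h.resolvent_sub (s + ω m) (s' + ω m) (by linarith [hω m]) (by linarith [hω m])
      rw [shiftedCayley, shiftedCayley]
      linear_combination (norm := module) (-(2 * ω m)) • this
    rw [e4]
    simp only [mul_add, add_mul, mul_smul_comm, smul_mul_assoc, mul_assoc]
    abel

lemma cayleyProd_mul_reverse (h : IsResolventFamily T R K c L β) {s : ℝ}
    (hs : 0 ≤ s) {ω : ℕ → ℝ} (hω : ∀ k, 0 < ω k) {n m : ℕ} (hm : m ≤ n) :
    cayleyProd R s ω m * cayleyProd R s (fun i => ω (n - 1 - i)) (n - m)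
      = cayleyProd R s ω n := by
  have h1 := h.cayleyProd_sub_cayleyProd_reverse hs hs hω hm
  have h2 := h.cayleyProd_sub_cayleyProd_reverse hs hs hω le_rfl (n := n)
  simp only [Nat.sub_self, sub_self, zero_smul, cayleyProd_zero, mul_one] at h1 h2
  rw [sub_eq_zero.1 h1, sub_eq_zero.1 h2]

end IsResolventFamily

/-- Bilinear Cauchy–Schwarz estimate for weighted sums of operator products. -/
lemma norm_sum_smul_mul_le [CompleteSpace H] {n : ℕ} {w : ℕ → ℝ} (hw : ∀ k, 0 ≤ w k)
    {a b : ℕ → H →L[ℂ] H} {C : ℝ} (hC : 0 ≤ C)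
    (ha : ∀ x, ∑ k ∈ Finset.range n, w k * ‖a k x‖ ^ 2 ≤ C * ‖x‖ ^ 2)
    (hb : ∀ y, ∑ k ∈ Finset.range n, w k * ‖star (b k) y‖ ^ 2 ≤ C * ‖y‖ ^ 2) :
    ‖∑ k ∈ Finset.range n, w k • (b k * a k)‖ ≤ C := by
  refine ContinuousLinearMap.opNorm_le_bound _ hC fun x => ?_
  set y := (∑ k ∈ Finset.range n, w k • (b k * a k)) x with hy
  have h1 : ‖y‖ ^ 2 ≤ ∑ k ∈ Finset.range n, w k * (‖star (b k) y‖ * ‖a k x‖) := by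
    have e : ‖y‖ ^ 2 = ‖∑ k ∈ Finset.range n, (w k : ℂ) * inner ℂ (star (b k) y) (a k x)‖ := by
      have : (inner ℂ y y : ℂ) =
          ∑ k ∈ Finset.range n, (w k : ℂ) * inner ℂ (star (b k) y) (a k x) := by
        nth_rw 2 [hy]
        rw [sum_apply, inner_sum]
        refine Finset.sum_congr rfl fun k _ => ?_
        rw [smul_apply, ← Complex.coe_smul, inner_smul_right,
          ContinuousLinearMap.star_eq_adjoint, ContinuousLinearMap.adjoint_inner_left]
        rfl
      rw [← this, inner_self_eq_norm_sq_to_K]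
      simp
    rw [e]
    refine (norm_sum_le _ _).trans (Finset.sum_le_sum fun k _ => ?_)
    rw [norm_mul, Complex.norm_real, Real.norm_of_nonneg (hw k)]
    exact mul_le_mul_of_nonneg_left (norm_inner_le_norm _ _) (hw k)
  have h2 : (∑ k ∈ Finset.range n, w k * (‖star (b k) y‖ * ‖a k x‖)) ^ 2
      ≤ (C * ‖y‖ * ‖x‖) ^ 2 := by
    have := Finset.sum_mul_sq_le_sq_mul_sq (Finset.range n)
      (fun k => √(w k) * ‖star (b k) y‖) (fun k => √(w k) * ‖a k x‖)
    simp only [mul_pow, Real.sq_sqrt (hw _)] at this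
    calc _ = (∑ k ∈ Finset.range n,
          √(w k) * ‖star (b k) y‖ * (√(w k) * ‖a k x‖)) ^ 2 := by
          congr 1
          refine Finset.sum_congr rfl fun k _ => ?_
          nth_rw 1 [← Real.mul_self_sqrt (hw k)]
          ring
      _ ≤ _ := this
      _ ≤ (C * ‖y‖ ^ 2) * (C * ‖x‖ ^ 2) := by
          refine mul_le_mul (hb y) (ha x) (Finset.sum_nonneg fun k _ => ?_) (by positivity)
          exact mul_nonneg (hw k) (sq_nonneg _)
      _ = _ := by ring
  have h3 := h1.trans ((le_abs_self _).trans (abs_le_of_sq_le_sq h2 (by positivity)))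
  rcases (norm_nonneg y).eq_or_lt with h0 | h0
  · rw [← h0]
    positivity
  · nlinarith

lemma natLog_add_one_le {n : ℕ} (hn : 1 ≤ n) :
    (Nat.log 2 n : ℝ) + 1 ≤ 3 * Real.log ((n : ℝ) + 1) := by
  have hn' : (1 : ℝ) ≤ n := by exact_mod_cast hn
  have h2 := Real.log_two_gt_d9
  have h3 : (Nat.log 2 n : ℝ) * Real.log 2 ≤ Real.log ((n : ℝ) + 1) := by
    rw [← Real.log_pow]
    refine Real.log_le_log (by positivity) ?_
    have : 2 ^ Nat.log 2 n ≤ n := Nat.pow_log_le_self 2 (by omega)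
    have : ((2 : ℝ) ^ Nat.log 2 n) ≤ n := by exact_mod_cast this
    linarith
  have h4 : Real.log 2 ≤ Real.log ((n : ℝ) + 1) := Real.log_le_log (by norm_num) (by linarith)
  have h5 : (0 : ℝ) ≤ Nat.log 2 n := by positivity
  nlinarith

namespace IsResolventFamily

variable {T R : ℝ → H →L[ℂ] H} {K c L β : ℝ}

lemma norm_cayleyProd_le_shift [CompleteSpace H] (h : IsResolventFamily T R K c L β) {s s' : ℝ}
    (hs : 0 ≤ s) (hs' : s ≤ s') {ω : ℕ → ℝ} (hω : ∀ k, 0 < ω k) (n : ℕ) :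
    ‖cayleyProd R s ω n‖ ≤ ‖cayleyProd R s' (fun i => ω (n - 1 - i)) n‖
      + (s' - s) * (K ^ 2 / (2 * (c + s))) := by
  have h1 := h.cayleyProd_sub_cayleyProd_reverse hs (hs.trans hs') hω le_rfl (n := n)
  simp only [Nat.sub_self, cayleyProd_zero, mul_one] at h1
  have hcs : 0 < c + s := by linarith [h.c_pos]
  have h2 : ‖∑ k ∈ Finset.range n, (2 * ω k) •
        ((cayleyProd R s ω k * R (s + ω k)) *
          (R (s' + ω k) * cayleyProd R s' (fun i => ω (n - 1 - i)) (n - 1 - k)))‖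
      ≤ K ^ 2 / (2 * (c + s)) := by
    refine norm_sum_smul_mul_le (fun k => by linarith [hω k]) (by positivity) (fun x => ?_)
      (fun y => ?_)
    · have h3 := h.sum_norm_sq_shifted_le (hs.trans hs') (ω := fun i => ω (n - 1 - i))
        (fun i => hω _) n x
      rw [← Finset.sum_range_reflect] at h3
      refine (Finset.sum_le_sum fun k hk => ?_).trans (h3.trans ?_)
      · have : n - 1 - (n - 1 - k) = k := by
          have := Finset.mem_range.1 hk
          omega
        simp only [this]
        exact le_rfl
      · gcongr
    · have h3 := h.adjoint.sum_norm_sq_shifted_le hs hω n y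
      refine (Finset.sum_le_sum fun k hk => ?_).trans h3
      rw [← h.star_cayleyProd hs hω k, star_mul]
      exact le_rfl
  rw [sub_eq_iff_eq_add'] at h1
  rw [h1]
  refine (norm_add_le _ _).trans ?_
  gcongr
  rw [norm_smul, Real.norm_eq_abs, abs_sub_comm, abs_of_nonneg (by linarith)]
  exact mul_le_mul_of_nonneg_left h2 (by linarith)

lemma exists_norm_cayleyProd_le_shift [CompleteSpace H] (h : IsResolventFamily T R K c L β)
    {W : ℝ} {ω : ℕ → ℝ} (hω : ∀ k, 0 < ω k ∧ ω k ≤ W) (n j : ℕ) :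
    ∃ ω' : ℕ → ℝ, (∀ k, 0 < ω' k ∧ ω' k ≤ W) ∧
      ‖cayleyProd R 0 ω n‖ ≤ ‖cayleyProd R (2 ^ j - 1) ω' n‖ + j * (K ^ 2 / (2 * c)) := by
  induction j with
  | zero => exact ⟨ω, hω, by simp⟩
  | succ j ih =>
    obtain ⟨ω', hω', hle⟩ := ih
    refine ⟨fun i => ω' (n - 1 - i), fun k => hω' _, hle.trans ?_⟩
    have h1 : (1 : ℝ) ≤ 2 ^ j := one_le_pow₀ (by norm_num)
    have h2 := h.norm_cayleyProd_le_shift (s := 2 ^ j - 1) (s' := 2 ^ (j + 1) - 1)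
      (by linarith) (by rw [pow_succ]; linarith) (fun k => (hω' k).1) n
    have hc := h.c_pos
    have hc1 := h.c_le_one
    have h3 : ((2 : ℝ) ^ (j + 1) - 1 - (2 ^ j - 1)) * (K ^ 2 / (2 * (c + (2 ^ j - 1))))
        ≤ K ^ 2 / (2 * c) := by
      rw [← mul_div_assoc, div_le_div_iff₀ (by nlinarith) (by positivity), pow_succ]
      have : c * 2 ^ j ≤ c + (2 ^ j - 1) := by nlinarith
      nlinarith [mul_le_mul_of_nonneg_left this (sq_nonneg K)]
    push_cast
    linarith

lemma norm_shiftedCayley_le (h : IsResolventFamily T R K c L β) {s w W : ℝ} (hs : 0 ≤ s)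
    (hw : 0 < w) (hW : w ≤ W) : ‖shiftedCayley R s w‖ ≤ 1 + 2 * W * (K / (c + s)) := by
  refine (norm_sub_le _ _).trans (add_le_add ContinuousLinearMap.norm_id_le ?_)
  have hc := h.c_pos
  have hK := h.K_nonneg
  rw [norm_smul, Real.norm_eq_abs, abs_of_pos (by positivity)]
  have h1 : ‖R (s + w)‖ ≤ K / (c + s) :=
    (h.norm_resolvent_le (s + w) (by linarith)).trans (by gcongr; linarith)
  have hW0 : 0 ≤ 2 * W := by linarith
  gcongr

/-- Cayley products grow at most logarithmically. -/
lemma norm_cayleyProd_le_log [CompleteSpace H] (h : IsResolventFamily T R K c L β) (W : ℝ) :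
    ∃ C : ℝ, 0 ≤ C ∧ ∀ n : ℕ, 1 ≤ n → ∀ ω : ℕ → ℝ, (∀ k, 0 < ω k ∧ ω k ≤ W) →
      ‖cayleyProd R 0 ω n‖ ≤ C * Real.log ((n : ℝ) + 1) := by
  have hc := h.c_pos
  have hK := h.K_nonneg
  refine ⟨3 * (Real.exp (2 * W * K) + K ^ 2 / (2 * c)), by positivity, fun n hn ω hω => ?_⟩
  obtain ⟨ω', hω', hle⟩ := h.exists_norm_cayleyProd_le_shift hω n (Nat.log 2 n + 1)
  have hW : 0 < W := (hω 0).1.trans_le (hω 0).2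
  have hn' : (1 : ℝ) ≤ n := by exact_mod_cast hn
  set s : ℝ := 2 ^ (Nat.log 2 n + 1) - 1 with hsdef
  have hsn : (n : ℝ) ≤ s := by
    have : n + 1 ≤ 2 ^ (Nat.log 2 n + 1) := Nat.lt_pow_succ_log_self (by norm_num) n
    have : (n : ℝ) + 1 ≤ 2 ^ (Nat.log 2 n + 1) := by exact_mod_cast this
    linarith
  have hs0 : 0 < s := by linarith
  have hprod : ∀ m : ℕ, ‖cayleyProd R s ω' m‖ ≤ (1 + 2 * W * (K / (c + s))) ^ m := by
    intro m
    induction m with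
    | zero => rw [cayleyProd_zero, pow_zero]; exact ContinuousLinearMap.norm_id_le
    | succ m ih =>
      rw [cayleyProd_succ, pow_succ]
      refine (norm_mul_le _ _).trans ?_
      gcongr
      exact h.norm_shiftedCayley_le hs0.le (hω' m).1 (hω' m).2
  have hexp : (1 + 2 * W * (K / (c + s))) ^ n ≤ Real.exp (2 * W * K) := by
    calc (1 + 2 * W * (K / (c + s))) ^ n ≤ Real.exp (2 * W * (K / (c + s))) ^ n := by
          gcongr
          linarith [Real.add_one_le_exp (2 * W * (K / (c + s)))]
      _ = Real.exp (2 * W * K * (n / (c + s))) := by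
          rw [← Real.exp_nat_mul]
          congr 1
          ring
      _ ≤ _ := by
          refine Real.exp_le_exp.2 (mul_le_of_le_one_right (by positivity) ?_)
          rw [div_le_one (by positivity)]
          linarith
  have hlog := natLog_add_one_le hn
  have h1 : (0 : ℝ) ≤ Nat.log 2 n := by positivity
  have hA := (hprod n).trans hexp
  have hq : 0 ≤ K ^ 2 / (2 * c) := by positivity
  push_cast at hle
  nlinarith [mul_le_mul_of_nonneg_right hlog hq,
    mul_le_mul_of_nonneg_right hlog (Real.exp_pos (2 * W * K)).le,
    mul_nonneg h1 (Real.exp_pos (2 * W * K)).le]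

lemma sum_norm_sq_resolvent_le (h : IsResolventFamily T R K c L β) {w W : ℝ} (hw : 0 < w)
    {ω : ℕ → ℝ} (hω : ∀ k, w ≤ ω k ∧ ω k ≤ W) (n : ℕ) {lam : ℝ} (hlam : 0 ≤ lam) (x : H) :
    ∑ k ∈ Finset.range n, ‖R lam (cayleyProd R 0 ω k x)‖ ^ 2
      ≤ (1 + W * (K / c)) ^ 2 / (2 * w) * L ^ 2 * (lam + 1) ^ (-β) * ‖x‖ ^ 2 := by
  have hω0 : ∀ k, 0 < ω k := fun k => hw.trans_le (hω k).1
  have hW : 0 < W := (hω0 0).trans_le (hω 0).2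
  have hc := h.c_pos
  have hK := h.K_nonneg
  have hterm : ∀ k, ‖R lam (cayleyProd R 0 ω k x)‖ ^ 2 ≤ (1 + W * (K / c)) ^ 2 / (2 * w) *
      (2 * ω k * ‖R (ω k) (cayleyProd R 0 ω k ((1 - lam • R lam) x))‖ ^ 2) := by
    intro k
    have e1 : R lam = R 0 * (1 - lam • R lam) := by
      have := h.resolvent_sub 0 lam le_rfl hlam
      rw [mul_sub, mul_one, mul_smul_comm]
      linear_combination (norm := module) (-1 : ℝ) • this
    have e2 : R 0 = (1 + ω k • R 0) * R (ω k) := by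
      have := h.resolvent_sub 0 (ω k) le_rfl (hω0 k).le
      rw [add_mul, one_mul, smul_mul_assoc]
      linear_combination (norm := module) (1 : ℝ) • this
    have e3 : R lam (cayleyProd R 0 ω k x) = (1 + ω k • R 0)
        (R (ω k) (cayleyProd R 0 ω k ((1 - lam • R lam) x))) := by
      have hcomm : Commute (1 - lam • R lam) (cayleyProd R 0 ω k) :=
        (Commute.one_left _).sub_left
          ((h.commute_resolvent_cayleyProd le_rfl hlam hω0 k).smul_left _)
      have : R lam * cayleyProd R 0 ω k = (1 + ω k • R 0) *
          (R (ω k) * (cayleyProd R 0 ω k * (1 - lam • R lam))) := by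
        rw [← hcomm.eq]
        conv_lhs => rw [e1, e2]
        simp only [mul_assoc]
      exact congrArg (fun Z : H →L[ℂ] H => Z x) this
    have e4 : ‖(1 : H →L[ℂ] H) + ω k • R 0‖ ≤ 1 + W * (K / c) := by
      refine (norm_add_le _ _).trans (add_le_add ContinuousLinearMap.norm_id_le ?_)
      rw [norm_smul, Real.norm_eq_abs, abs_of_pos (hω0 k)]
      have := h.norm_resolvent_le 0 le_rfl
      rw [add_zero] at this
      gcongr
      exact (hω k).2
    rw [e3]
    set z := R (ω k) (cayleyProd R 0 ω k ((1 - lam • R lam) x))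
    calc _ ≤ ((1 + W * (K / c)) * ‖z‖) ^ 2 := by
          gcongr
          exact ContinuousLinearMap.le_of_opNorm_le _ e4 z
      _ = (1 + W * (K / c)) ^ 2 / (2 * w) * (2 * w * ‖z‖ ^ 2) := by field_simp
      _ ≤ _ := by
          gcongr
          exact (hω k).1
  refine (Finset.sum_le_sum fun k _ => hterm k).trans ?_
  rw [← Finset.mul_sum]
  have := h.sum_norm_sq_smoothing_le hω0 n hlam x
  calc _ ≤ (1 + W * (K / c)) ^ 2 / (2 * w) * (L ^ 2 * (lam + 1) ^ (-β) * ‖x‖ ^ 2) := by gcongr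
    _ = _ := by ring

/-- Frequency-localised decay of Cayley products. -/
lemma norm_cayleyProd_mul_resolvent_mul_resolvent_le [CompleteSpace H]
    (h : IsResolventFamily T R K c L β) (hβ : 0 ≤ β) {w W : ℝ} (hw : 0 < w)
    {ω : ℕ → ℝ} (hω : ∀ k, w ≤ ω k ∧ ω k ≤ W) (n : ℕ) {lam mu : ℝ} (hlam : 0 ≤ lam)
    (hmu : lam ≤ mu) :
    n * ‖cayleyProd R 0 ω n * (R lam * R mu)‖
      ≤ (1 + W * (K / c)) ^ 2 / (2 * w) * L ^ 2 * (lam + 1) ^ (-β) := by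
  have hω0 : ∀ k, 0 < ω k := fun k => hw.trans_le (hω k).1
  set C := (1 + W * (K / c)) ^ 2 / (2 * w) * L ^ 2
  have hC : 0 ≤ C := by positivity
  have hp : 0 < lam + 1 := by linarith
  have h1 : (n : ℝ) • (cayleyProd R 0 ω n * (R lam * R mu)) =
      ∑ k ∈ Finset.range n, (1 : ℝ) • ((cayleyProd R 0 ω k * R lam) *
        (R mu * cayleyProd R 0 (fun i => ω (n - 1 - i)) (n - k))) := by
    have : ∀ k ∈ Finset.range n, (1 : ℝ) • ((cayleyProd R 0 ω k * R lam) *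
        (R mu * cayleyProd R 0 (fun i => ω (n - 1 - i)) (n - k)))
        = cayleyProd R 0 ω n * (R lam * R mu) := by
      intro k hk
      rw [one_smul, ← h.cayleyProd_mul_reverse le_rfl hω0 (Finset.mem_range.1 hk).le]
      have hcomm : Commute (R lam * R mu) (cayleyProd R 0 (fun i => ω (n - 1 - i)) (n - k)) :=
        (h.commute_resolvent_cayleyProd le_rfl hlam (fun i => hω0 _) _).mul_left
          (h.commute_resolvent_cayleyProd le_rfl (hlam.trans hmu) (fun i => hω0 _) _)
      rw [mul_assoc (cayleyProd R 0 ω k) (cayleyProd R 0 _ (n - k)), ← hcomm.eq]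
      simp only [mul_assoc]
    rw [Finset.sum_congr rfl this, Finset.sum_const, Finset.card_range, Nat.cast_smul_eq_nsmul]
  have h2 : ‖(n : ℝ) • (cayleyProd R 0 ω n * (R lam * R mu))‖ ≤ C * (lam + 1) ^ (-β) := by
    rw [h1]
    refine norm_sum_smul_mul_le (fun _ => zero_le_one) (by positivity) (fun x => ?_) (fun y => ?_)
    · have h3 := h.sum_norm_sq_resolvent_le hw (ω := fun i => ω (n - 1 - i)) (fun i => hω _)
        (n + 1) (hlam.trans hmu) x
      rw [Finset.sum_range_succ', ← Finset.sum_range_reflect] at h3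
      have h4 : (mu + 1) ^ (-β) ≤ (lam + 1) ^ (-β) :=
        Real.rpow_le_rpow_of_nonpos hp (by linarith) (by linarith)
      have h5 : C * (mu + 1) ^ (-β) * ‖x‖ ^ 2 ≤ C * (lam + 1) ^ (-β) * ‖x‖ ^ 2 := by gcongr
      refine le_trans ?_ (h3.trans h5)
      refine (Finset.sum_le_sum fun k hk => ?_).trans (le_add_of_nonneg_right (sq_nonneg _))
      have : n - 1 - k + 1 = n - k := by
        have := Finset.mem_range.1 hk
        omega
      rw [this, one_mul]
      exact le_rfl
    · have h3 := h.adjoint.sum_norm_sq_resolvent_le hw hω n hlam y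
      refine (Finset.sum_le_sum fun k _ => ?_).trans h3
      rw [← h.star_cayleyProd le_rfl hω0 k, star_mul, one_mul]
      exact le_rfl
  rwa [norm_smul, Real.norm_eq_abs, abs_of_nonneg (Nat.cast_nonneg n)] at h2

lemma resolvent_zero_eq_sum (h : IsResolventFamily T R K c L β) (J : ℕ) :
    R 0 = R (2 ^ J - 1) + ∑ j ∈ Finset.range J,
      (2 : ℝ) ^ j • (R (2 ^ j - 1) * R (2 ^ (j + 1) - 1)) := by
  induction J with
  | zero => simp
  | succ J ih =>
    have h1 : ∀ j : ℕ, (0 : ℝ) ≤ 2 ^ j - 1 := fun j => by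
      linarith [one_le_pow₀ (n := j) (by norm_num : (1 : ℝ) ≤ 2)]
    have h2 := h.resolvent_sub _ _ (h1 J) (h1 (J + 1))
    rw [Finset.sum_range_succ]
    have h3 : (2 : ℝ) ^ (J + 1) - 1 - (2 ^ J - 1) = 2 ^ J := by ring
    rw [h3] at h2
    rw [← h2]
    nth_rw 1 [ih]
    abel

/-- Decay of Cayley products on the domain. -/
lemma norm_cayleyProd_mul_resolvent_zero_le [CompleteSpace H]
    (h : IsResolventFamily T R K c L β) (hβ0 : 0 ≤ β) (hβ1 : β ≤ 1) {w : ℝ} (W : ℝ)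
    (hw : 0 < w) :
    ∃ C : ℝ, 0 ≤ C ∧ ∀ n : ℕ, 1 ≤ n → ∀ ω : ℕ → ℝ, (∀ k, w ≤ ω k ∧ ω k ≤ W) →
      ‖cayleyProd R 0 ω n * R 0‖
        ≤ C * (Real.log ((n : ℝ) + 1) * (n : ℝ) ^ (-(1 / (2 - β)))) := by
  obtain ⟨C₁, hC₁, hlog⟩ := h.norm_cayleyProd_le_log W
  set C₂ := (1 + W * (K / c)) ^ 2 / (2 * w) * L ^ 2
  have hC₂ : 0 ≤ C₂ := by positivity
  have hc := h.c_pos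
  have hc1 := h.c_le_one
  have hK := h.K_nonneg
  refine ⟨C₁ * (K / c) + 3 * C₂, by positivity, fun n hn ω hω => ?_⟩
  have hn' : (1 : ℝ) ≤ n := by exact_mod_cast hn
  have hn0 : (0 : ℝ) < n := by linarith
  have h2β : 0 < 2 - β := by linarith
  set ν : ℝ := (n : ℝ) ^ (1 / (2 - β)) with hν
  have hν1 : 1 ≤ ν := Real.one_le_rpow hn' (by positivity)
  have hνn : ν ≤ n := by
    calc ν ≤ (n : ℝ) ^ (1 : ℝ) :=
          Real.rpow_le_rpow_of_exponent_le hn' (by rw [div_le_one h2β]; linarith)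
      _ = n := Real.rpow_one _
  have hνinv : (n : ℝ) ^ (-(1 / (2 - β))) = ν⁻¹ := Real.rpow_neg hn0.le _
  set m := ⌊ν⌋₊ with hm
  have hm1 : 1 ≤ m := Nat.le_floor (by simpa using hν1)
  have hmn : m ≤ n := by
    have : (m : ℝ) ≤ n := (Nat.floor_le (by linarith)).trans hνn
    exact_mod_cast this
  set J := Nat.log 2 m + 1 with hJ
  have hJν : ν ≤ 2 ^ J := by
    have h1 : m + 1 ≤ 2 ^ J := Nat.lt_pow_succ_log_self (by norm_num) m
    have h2 : (m : ℝ) + 1 ≤ 2 ^ J := by exact_mod_cast h1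
    linarith [Nat.lt_floor_add_one ν]
  have hjν : ∀ j ∈ Finset.range J, (2 : ℝ) ^ j ≤ ν := by
    intro j hj
    have h1 : 2 ^ j ≤ m :=
      (Nat.pow_le_pow_right (by norm_num) (Nat.lt_succ_iff.1 (Finset.mem_range.1 hj))).trans
        (Nat.pow_log_le_self 2 (by omega))
    have h2 : (2 : ℝ) ^ j ≤ m := by exact_mod_cast h1
    exact h2.trans (Nat.floor_le (by linarith))
  have hJlog : (J : ℝ) ≤ 3 * Real.log ((n : ℝ) + 1) := by
    refine le_trans ?_ (natLog_add_one_le hn)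
    rw [hJ]
    push_cast
    have : (Nat.log 2 m : ℝ) ≤ Nat.log 2 n := by exact_mod_cast Nat.log_mono_right hmn
    linarith
  have hlog0 : 0 ≤ Real.log ((n : ℝ) + 1) := Real.log_nonneg (by linarith)
  have hhigh : ‖cayleyProd R 0 ω n * R (2 ^ J - 1)‖
      ≤ C₁ * (K / c) * (Real.log ((n : ℝ) + 1) * ν⁻¹) := by
    have h1 : ‖R (2 ^ J - 1)‖ ≤ K / c * ν⁻¹ := by
      refine (h.norm_resolvent_le _ (by linarith)).trans ?_
      rw [← div_eq_mul_inv, div_div]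
      have : c * ν ≤ c + (2 ^ J - 1) := by nlinarith
      gcongr
    calc _ ≤ _ := norm_mul_le _ _
      _ ≤ (C₁ * Real.log ((n : ℝ) + 1)) * (K / c * ν⁻¹) := by
          gcongr
          exact hlog n hn ω fun k => ⟨hw.trans_le (hω k).1, (hω k).2⟩
      _ = _ := by ring
  have hterm : ∀ j ∈ Finset.range J, ‖cayleyProd R 0 ω n *
      ((2 : ℝ) ^ j • (R (2 ^ j - 1) * R (2 ^ (j + 1) - 1)))‖ ≤ C₂ * ν⁻¹ := by
    intro j hj
    have h1 : (1 : ℝ) ≤ 2 ^ j := one_le_pow₀ (by norm_num)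
    have h2 := h.norm_cayleyProd_mul_resolvent_mul_resolvent_le hβ0 hw hω n
      (lam := 2 ^ j - 1) (mu := 2 ^ (j + 1) - 1) (by linarith) (by rw [pow_succ]; linarith)
    rw [sub_add_cancel] at h2
    rw [mul_smul_comm, norm_smul, Real.norm_eq_abs, abs_of_pos (by positivity)]
    set q := ‖cayleyProd R 0 ω n * (R (2 ^ j - 1) * R (2 ^ (j + 1) - 1))‖
    have h3 : (2 : ℝ) ^ j * ((2 : ℝ) ^ j) ^ (-β) ≤ n * ν⁻¹ := by
      calc (2 : ℝ) ^ j * ((2 : ℝ) ^ j) ^ (-β) = ((2 : ℝ) ^ j) ^ (1 - β) := by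
            rw [sub_eq_add_neg, Real.rpow_add (by positivity), Real.rpow_one]
        _ ≤ ν ^ (1 - β) := Real.rpow_le_rpow (by positivity) (hjν j hj) (by linarith)
        _ = n * ν⁻¹ := by
            rw [← hνinv, hν, ← Real.rpow_mul hn0.le]
            nth_rw 2 [← Real.rpow_one (n : ℝ)]
            rw [← Real.rpow_add hn0]
            congr 1
            field_simp
            ring
    have h4 : (n : ℝ) * (2 ^ j * q) ≤ n * (C₂ * ν⁻¹) := by
      calc (n : ℝ) * (2 ^ j * q) = 2 ^ j * (n * q) := by ring
        _ ≤ 2 ^ j * (C₂ * ((2 : ℝ) ^ j) ^ (-β)) := by gcongr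
        _ = C₂ * (2 ^ j * ((2 : ℝ) ^ j) ^ (-β)) := by ring
        _ ≤ C₂ * (n * ν⁻¹) := by gcongr
        _ = _ := by ring
    exact le_of_mul_le_mul_left h4 hn0
  rw [hνinv, h.resolvent_zero_eq_sum J, mul_add, Finset.mul_sum]
  calc _ ≤ _ := norm_add_le _ _
    _ ≤ C₁ * (K / c) * (Real.log ((n : ℝ) + 1) * ν⁻¹) + J * (C₂ * ν⁻¹) := by
        refine add_le_add hhigh ((norm_sum_le _ _).trans ((Finset.sum_le_sum hterm).trans ?_))
        simp
    _ ≤ C₁ * (K / c) * (Real.log ((n : ℝ) + 1) * ν⁻¹)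
        + 3 * Real.log ((n : ℝ) + 1) * (C₂ * ν⁻¹) := by gcongr
    _ = _ := by ring

/-- Decay of Cayley products on the domains of integer powers. -/
lemma norm_cayleyProd_mul_resolvent_zero_pow_le [CompleteSpace H]
    (h : IsResolventFamily T R K c L β) (hβ0 : 0 ≤ β) (hβ1 : β ≤ 1) {w : ℝ} (W : ℝ)
    (hw : 0 < w) (a : ℕ) :
    ∃ C : ℝ, 0 ≤ C ∧ ∀ n : ℕ, 1 ≤ n → ∀ ω : ℕ → ℝ, (∀ k, w ≤ ω k ∧ ω k ≤ W) →
      ‖cayleyProd R 0 ω n * R 0 ^ (a + 1)‖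
        ≤ C * (Real.log ((n : ℝ) + 1) * (n : ℝ) ^ (-(1 / (2 - β)))) ^ (a + 1) := by
  obtain ⟨C₁, hC₁, hone⟩ := h.norm_cayleyProd_mul_resolvent_zero_le hβ0 hβ1 W hw
  have h2β : 0 < 2 - β := by linarith
  induction a with
  | zero => exact ⟨C₁, hC₁, by simpa using hone⟩
  | succ a ih =>
    obtain ⟨C₂, hC₂, hpow⟩ := ih
    set g : ℕ → ℝ := fun n => Real.log ((n : ℝ) + 1) * (n : ℝ) ^ (-(1 / (2 - β))) with hg
    have hg0 : ∀ n, 0 ≤ g n := fun n =>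
      mul_nonneg (Real.log_nonneg (by linarith [Nat.cast_nonneg (α := ℝ) n]))
        (Real.rpow_nonneg (Nat.cast_nonneg n) _)
    have hsub : ∀ m n : ℕ, 1 ≤ m → m ≤ n → n ≤ 3 * m → g m ≤ 3 * g n := by
      intro m n hm hmn hnm
      have hm' : (1 : ℝ) ≤ m := by exact_mod_cast hm
      have hmn' : (m : ℝ) ≤ n := by exact_mod_cast hmn
      have hnm' : (n : ℝ) ≤ 3 * m := by exact_mod_cast hnm
      have e1 : Real.log ((m : ℝ) + 1) ≤ Real.log ((n : ℝ) + 1) :=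
        Real.log_le_log (by linarith) (by linarith)
      have e2 : (m : ℝ) ^ (-(1 / (2 - β))) ≤ 3 * (n : ℝ) ^ (-(1 / (2 - β))) := by
        have h3 : ((3 : ℝ) * m) ^ (-(1 / (2 - β))) ≤ (n : ℝ) ^ (-(1 / (2 - β))) :=
          Real.rpow_le_rpow_of_nonpos (by linarith) hnm' (by
            have : 0 < 1 / (2 - β) := by positivity
            linarith)
        rw [Real.mul_rpow (by norm_num) (by linarith)] at h3
        have h4 : (3 : ℝ)⁻¹ ≤ 3 ^ (-(1 / (2 - β))) := by
          rw [← Real.rpow_neg_one]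
          refine Real.rpow_le_rpow_of_exponent_le (by norm_num) ?_
          rw [neg_le_neg_iff, div_le_one h2β]
          linarith
        have h5 : 0 ≤ (m : ℝ) ^ (-(1 / (2 - β))) := by positivity
        nlinarith [mul_le_mul_of_nonneg_right h4 h5]
      have e3 : 0 ≤ Real.log ((n : ℝ) + 1) := Real.log_nonneg (by linarith)
      calc g m ≤ Real.log ((n : ℝ) + 1) * (3 * (n : ℝ) ^ (-(1 / (2 - β)))) := by
            simp only [hg]
            gcongr
        _ = 3 * g n := by simp only [hg]; ring
    have hone_pos : 0 < g 1 := by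
      simp only [hg, Nat.cast_one, Real.one_rpow, mul_one]
      exact Real.log_pos (by norm_num)
    have hc := h.c_pos
    have hK := h.K_nonneg
    refine ⟨max (C₂ * 3 ^ (a + 1) * (C₁ * 3)) (C₁ * (K / c) ^ (a + 1) / g 1 ^ (a + 1)),
      le_max_of_le_left (by positivity), fun n hn ω hω => ?_⟩
    have hω0 : ∀ k, 0 < ω k := fun k => hw.trans_le (hω k).1
    change _ ≤ _ * g n ^ (a + 1 + 1)
    rcases Nat.lt_or_ge n 2 with hlt | hge
    · obtain rfl : n = 1 := by omega
      have h0 := h.norm_resolvent_le 0 le_rfl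
      rw [add_zero] at h0
      calc ‖cayleyProd R 0 ω 1 * R 0 ^ (a + 1 + 1)‖
          = ‖cayleyProd R 0 ω 1 * R 0 * R 0 ^ (a + 1)‖ := by rw [pow_succ', mul_assoc]
        _ ≤ _ := norm_mul_le _ _
        _ ≤ (C₁ * g 1) * (K / c) ^ (a + 1) := by
            gcongr
            · exact hone 1 le_rfl ω hω
            · exact (norm_pow_le' _ (Nat.succ_pos a)).trans (by gcongr)
        _ = C₁ * (K / c) ^ (a + 1) / g 1 ^ (a + 1) * g 1 ^ (a + 1 + 1) := by
            rw [pow_succ (g 1) (a + 1)]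
            field_simp
        _ ≤ _ := mul_le_mul_of_nonneg_right (le_max_right _ _) (pow_nonneg (hg0 1) _)
    · obtain ⟨m, k, rfl, hm, hk, hm3, hk3⟩ : ∃ m k : ℕ, n = m + k ∧ 1 ≤ m ∧ 1 ≤ k ∧
          n ≤ 3 * m ∧ n ≤ 3 * k :=
        ⟨n / 2, n - n / 2, by omega, by omega, by omega, by omega, by omega⟩
      have hcomm : Commute (R 0 ^ (a + 1)) (cayleyProd R 0 (fun i => ω (m + i)) k) :=
        (h.commute_resolvent_cayleyProd le_rfl le_rfl (fun i => hω0 _) k).pow_left _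
      have e : cayleyProd R 0 ω (m + k) * R 0 ^ (a + 1 + 1) =
          (cayleyProd R 0 ω m * R 0 ^ (a + 1)) *
            (cayleyProd R 0 (fun i => ω (m + i)) k * R 0) := by
        rw [cayleyProd_add, pow_succ, mul_assoc, ← mul_assoc (cayleyProd R 0 _ k), ← hcomm.eq]
        simp only [mul_assoc]
      rw [e]
      calc _ ≤ _ := norm_mul_le _ _
        _ ≤ (C₂ * g m ^ (a + 1)) * (C₁ * g k) := by
            gcongr
            · exact mul_nonneg hC₂ (pow_nonneg (hg0 m) _)
            · exact hpow m hm ω hω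
            · exact hone k hk _ fun i => hω _
        _ ≤ (C₂ * (3 * g (m + k)) ^ (a + 1)) * (C₁ * (3 * g (m + k))) := by
            have h1 := hsub m (m + k) hm (by omega) hm3
            have h2 := hsub k (m + k) hk (by omega) hk3
            have := hg0 m
            have := hg0 k
            have := hg0 (m + k)
            gcongr
        _ = C₂ * 3 ^ (a + 1) * (C₁ * 3) * g (m + k) ^ (a + 1 + 1) := by ring
        _ ≤ _ := mul_le_mul_of_nonneg_right (le_max_left _ _) (pow_nonneg (hg0 _) _)

end IsResolventFamily

/-- The resolvent `(lam + A)⁻¹` as the Laplace transform of the semigroup. -/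
def laplaceResolvent (T : ℝ → H →L[ℂ] H) (lam : ℝ) : H →L[ℂ] H :=
  ∫ t in Set.Ioi (0 : ℝ), Real.exp (-(lam * t)) • T t

section Generator

variable {T B : ℝ → H →L[ℂ] H} {A : H →ₗ.[ℂ] H} {J : H →L[ℂ] H} {K c β : ℝ}

lemma IsResolventAt.mul_left_cancel (hJ : IsResolventAt A 0 J) {X Y : H →L[ℂ] H}
    (hXY : J * X = J * Y) : X = Y := by
  ext x
  have h1 : J (X x) = J (Y x) := congrArg (fun Z : H →L[ℂ] H => Z x) hXY
  obtain ⟨hX, eX⟩ := hJ.1 (X x)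
  obtain ⟨hY, eY⟩ := hJ.1 (Y x)
  rw [← eX, ← eY]
  simp only [h1]

/-- Orbits starting in the range of `J = A⁻¹` are right differentiable. -/
lemma IsGenerator.hasDerivWithinAt (hT : IsC0Semigroup T) (hgen : IsGenerator T A)
    (hJ : IsResolventAt A 0 J) {t : ℝ} (ht : 0 ≤ t) (x : H) :
    HasDerivWithinAt (fun u => T u (J x)) (-T t x) (Set.Ici t) t := by
  obtain ⟨hx, hAx⟩ := hJ.1 x
  have h0 := hgen.2 ⟨J x, hx⟩
  rw [zero_smul, zero_add] at hAx
  rw [hAx] at h0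
  rw [← hasDerivWithinAt_Ioi_iff_Ici, hasDerivWithinAt_iff_tendsto_slope' (by simp)]
  have h1 : Tendsto (fun s : ℝ => s - t) (𝓝[>] t) (𝓝[>] 0) := by
    refine tendsto_nhdsWithin_iff.2 ⟨?_, ?_⟩
    · have : Tendsto (fun s : ℝ => s - t) (𝓝 t) (𝓝 (t - t)) :=
        tendsto_id.sub_const t
      rw [sub_self] at this
      exact this.mono_left nhdsWithin_le_nhds
    · filter_upwards [self_mem_nhdsWithin] with s hs
      exact sub_pos.2 (Set.mem_Ioi.1 hs)
  have h2 := ((T t).continuous.tendsto _).comp (h0.comp h1)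
  rw [map_neg] at h2
  refine h2.congr' ?_
  filter_upwards [self_mem_nhdsWithin] with s hs
  have hs' : 0 ≤ s - t := (sub_pos.2 hs).le
  have h3 : T s = T t ∘L T (s - t) := by rw [← hT.map_add t (s - t) ht hs', add_sub_cancel]
  simp only [Function.comp, slope, vsub_eq_sub, map_smul, map_sub, h3,
    ContinuousLinearMap.comp_apply]
  rw [← Complex.ofReal_inv, Complex.coe_smul]

lemma IsGenerator.commute_inverse (hT : IsC0Semigroup T) (hgen : IsGenerator T A)
    (hJ : IsResolventAt A 0 J) {t : ℝ} (ht : 0 ≤ t) : Commute (T t) J := by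
  ext x
  obtain ⟨hx, hAx⟩ := hJ.1 x
  rw [zero_smul, zero_add] at hAx
  have h0 := hgen.2 ⟨J x, hx⟩
  rw [hAx] at h0
  have h1 : Tendsto (fun h : ℝ => (h : ℂ)⁻¹ • (T h (T t (J x)) - T t (J x))) (𝓝[>] 0)
      (𝓝 (-T t x)) := by
    have h2 := ((T t).continuous.tendsto _).comp h0
    rw [map_neg] at h2
    refine h2.congr' ?_
    filter_upwards [self_mem_nhdsWithin] with s hs
    have h3 : T t (T s (J x)) = T s (T t (J x)) := by
      have h4 : T t ∘L T s = T s ∘L T t := by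
        rw [← hT.map_add t s ht (le_of_lt hs), ← hT.map_add s t (le_of_lt hs) ht, add_comm]
      exact congrArg (fun Z : H →L[ℂ] H => Z (J x)) h4
    simp only [Function.comp, map_smul, map_sub, h3]
  have hmem : T t (J x) ∈ A.domain := (hgen.1 _).2 ⟨_, h1⟩
  have h4 : A ⟨T t (J x), hmem⟩ = T t x :=
    neg_injective (tendsto_nhds_unique (hgen.2 ⟨T t (J x), hmem⟩) h1)
  have h5 := hJ.2 ⟨T t (J x), hmem⟩
  rw [zero_smul, zero_add, h4] at h5
  exact h5.symm

lemma IsGenerator.norm_mul_inverse_sub_le (hT : IsC0Semigroup T) (hgen : IsGenerator T A)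
    (hJ : IsResolventAt A 0 J) (hK : 0 ≤ K) (hTK : ∀ t, 0 ≤ t → ‖T t‖ ≤ K) {s t : ℝ}
    (hs : 0 ≤ s) (hst : s ≤ t) : ‖T t * J - T s * J‖ ≤ K * (t - s) := by
  refine ContinuousLinearMap.opNorm_le_bound _ (mul_nonneg hK (by linarith)) fun x => ?_
  have h := norm_image_sub_le_of_norm_deriv_right_le_segment
    (f := fun u => T u (J x)) (f' := fun u => -T u x) (C := K * ‖x‖) (a := s) (b := t)
    ((hT.strong_continuity _).mono fun u hu => hs.trans hu.1)
    (fun u hu => hgen.hasDerivWithinAt hT hJ (hs.trans hu.1) _)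
    (fun u hu => by
      rw [norm_neg]
      exact (T u).le_of_opNorm_le (hTK u (hs.trans hu.1)) _)
    t ⟨hst, le_rfl⟩
  calc _ ≤ K * ‖x‖ * (t - s) := h
    _ = K * (t - s) * ‖x‖ := by ring

lemma IsGenerator.tendsto_mul_inverse (hT : IsC0Semigroup T) (hgen : IsGenerator T A)
    (hJ : IsResolventAt A 0 J) (hK : 0 ≤ K) (hTK : ∀ t, 0 ≤ t → ‖T t‖ ≤ K) :
    Tendsto (fun t => T t * J) (𝓝[>] 0) (𝓝 J) := by
  rw [tendsto_iff_norm_sub_tendsto_zero]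
  have h1 : Tendsto (fun t : ℝ => K * t) (𝓝[>] 0) (𝓝 0) := by
    have h2 : Tendsto (fun t : ℝ => K * t) (𝓝 0) (𝓝 (K * 0)) := tendsto_id.const_mul K
    rw [mul_zero] at h2
    exact h2.mono_left nhdsWithin_le_nhds
  refine squeeze_zero' (Eventually.of_forall fun _ => norm_nonneg _) ?_ h1
  filter_upwards [self_mem_nhdsWithin] with t ht
  simpa [hT.map_zero] using hgen.norm_mul_inverse_sub_le hT hJ hK hTK le_rfl (le_of_lt ht)

/-- If `T t = J * B t` for positive times then `T` is norm continuous there. -/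
lemma IsGenerator.continuousOn_semigroup (hT : IsC0Semigroup T) (hgen : IsGenerator T A)
    (hJ : IsResolventAt A 0 J) (hK : 0 ≤ K) (hTK : ∀ t, 0 ≤ t → ‖T t‖ ≤ K)
    (hB : ∀ t, 0 < t → J * B t = T t) : ContinuousOn T (Set.Ioi 0) := by
  have hlip : ∀ a s t : ℝ, 0 < a → a ≤ s → s ≤ t → ‖T t - T s‖ ≤ K * ‖B a‖ * (t - s) := by
    intro a s t ha has hst
    have hsplit : ∀ u, a ≤ u → T u = T (u - a) * J * B a := by
      intro u hu
      have h1 : T u = T (u - a) ∘L T a := by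
        rw [← hT.map_add (u - a) a (by linarith) ha.le, sub_add_cancel]
      rw [h1, mul_assoc, hB a ha]
      rfl
    rw [hsplit t (by linarith), hsplit s has, ← sub_mul]
    have h2 := hgen.norm_mul_inverse_sub_le hT hJ hK hTK (sub_nonneg.2 has)
      (by linarith : s - a ≤ t - a)
    calc _ ≤ ‖T (t - a) * J - T (s - a) * J‖ * ‖B a‖ := norm_mul_le _ _
      _ ≤ K * (t - a - (s - a)) * ‖B a‖ := by gcongr
      _ = K * ‖B a‖ * (t - s) := by ring
  intro t ht
  have ht' : 0 < t := ht
  have hL : LipschitzOnWith (K * ‖B (t / 2)‖).toNNReal T (Set.Ici (t / 2)) := by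
    refine LipschitzOnWith.of_dist_le_mul fun u hu v hv => ?_
    rw [Real.coe_toNNReal _ (by positivity), dist_eq_norm, Real.dist_eq]
    rcases le_total u v with huv | huv
    · rw [norm_sub_rev, abs_sub_comm, abs_of_nonneg (by linarith : 0 ≤ v - u)]
      exact hlip _ _ _ (by linarith) hu huv
    · rw [abs_of_nonneg (by linarith : 0 ≤ u - v)]
      exact hlip _ _ _ (by linarith) hv huv
  exact (hL.continuousOn.continuousAt (Ici_mem_nhds (by linarith))).continuousWithinAt

lemma IsGenerator.hasDerivAt_mul_inverse [CompleteSpace H] (hT : IsC0Semigroup T)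
    (hgen : IsGenerator T A) (hJ : IsResolventAt A 0 J) (hcont : ContinuousOn T (Set.Ioi 0))
    {t : ℝ} (ht : 0 < t) : HasDerivAt (fun u => T u * J) (-T t) t := by
  have hint : ∀ u, 0 < u → IntervalIntegrable T MeasureTheory.volume t u := fun u hu =>
    (hcont.mono fun v hv => lt_of_lt_of_le (lt_min ht hu) hv.1).intervalIntegrable
  have h1 : HasDerivAt (fun u => T t * J - ∫ v in t..u, T v) (-T t) t := by
    have h2 := intervalIntegral.integral_hasDerivAt_right (hint t ht)
      (hcont.stronglyMeasurableAtFilter isOpen_Ioi t ht)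
      (hcont.continuousAt (Ioi_mem_nhds ht))
    simpa using h2.const_sub (T t * J)
  refine h1.congr_of_eventuallyEq ?_
  filter_upwards [Ioi_mem_nhds ht] with u hu
  ext x
  have h3 := intervalIntegral.integral_eq_sub_of_hasDeriv_right (a := t) (b := u)
    (f := fun v => T v (J x)) (f' := fun v => -T v x)
    ((hT.strong_continuity _).mono fun v hv => (lt_of_lt_of_le (lt_min ht hu) hv.1).le)
    (fun v hv => (hasDerivWithinAt_Ioi_iff_Ici.2 (hgen.hasDerivWithinAt hT hJ
      ((lt_min ht hu).trans hv.1).le x)))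
    (((hcont.clm_apply continuousOn_const).mono fun v hv =>
      lt_of_lt_of_le (lt_min ht hu) hv.1).neg.intervalIntegrable)
  rw [intervalIntegral.integral_neg] at h3
  rw [sub_apply, ContinuousLinearMap.intervalIntegral_apply (hint u hu)]
  change T u (J x) = T t (J x) - _
  rw [sub_eq_add_neg, h3]
  abel

lemma integrableOn_exp_smul_semigroup (hc : 0 < c) (hcont : ContinuousOn T (Set.Ioi 0))
    (hTK : ∀ t, 0 < t → ‖T t‖ ≤ K * Real.exp (-(c * t))) {lam : ℝ} (hlam : 0 ≤ lam) :
    MeasureTheory.IntegrableOn (fun t => Real.exp (-(lam * t)) • T t) (Set.Ioi 0) := by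
  have h1 : MeasureTheory.IntegrableOn (fun t => K * Real.exp (-(c + lam) * t)) (Set.Ioi 0) :=
    (integrableOn_exp_mul_Ioi (by linarith) 0).const_mul K
  refine MeasureTheory.Integrable.mono' h1
    (ContinuousOn.aestronglyMeasurable (by fun_prop) measurableSet_Ioi) ?_
  refine (MeasureTheory.ae_restrict_iff' measurableSet_Ioi).2 (MeasureTheory.ae_of_all _ fun t ht => ?_)
  rw [norm_smul, Real.norm_eq_abs, Real.abs_exp]
  calc _ ≤ Real.exp (-(lam * t)) * (K * Real.exp (-(c * t))) := by
        gcongr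
        exact hTK t ht
    _ = K * Real.exp (-(c + lam) * t) := by
        rw [mul_left_comm, ← Real.exp_add]
        ring_nf

lemma norm_laplaceResolvent_le (hc : 0 < c)
    (hTK : ∀ t, 0 < t → ‖T t‖ ≤ K * Real.exp (-(c * t))) {lam : ℝ} (hlam : 0 ≤ lam) :
    ‖laplaceResolvent T lam‖ ≤ K / (c + lam) := by
  have h1 : MeasureTheory.IntegrableOn (fun t => K * Real.exp (-(c + lam) * t)) (Set.Ioi 0) :=
    (integrableOn_exp_mul_Ioi (by linarith) 0).const_mul K
  have h2 : ∫ t in Set.Ioi (0 : ℝ), K * Real.exp (-(c + lam) * t) = K / (c + lam) := by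
    rw [MeasureTheory.integral_const_mul, integral_exp_mul_Ioi (by linarith)]
    simp only [mul_zero, Real.exp_zero]
    rw [neg_div_neg_eq, mul_one_div]
  rw [← h2]
  refine MeasureTheory.norm_integral_le_of_norm_le h1 ?_
  refine (MeasureTheory.ae_restrict_iff' measurableSet_Ioi).2 (MeasureTheory.ae_of_all _ fun t ht => ?_)
  rw [norm_smul, Real.norm_eq_abs, Real.abs_exp]
  calc _ ≤ Real.exp (-(lam * t)) * (K * Real.exp (-(c * t))) := by
        gcongr
        exact hTK t ht
    _ = K * Real.exp (-(c + lam) * t) := by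
        rw [mul_left_comm, ← Real.exp_add]
        ring_nf

lemma commute_laplaceResolvent {lam : ℝ}
    (hint : MeasureTheory.IntegrableOn (fun t => Real.exp (-(lam * t)) • T t) (Set.Ioi 0))
    {Z : H →L[ℂ] H} (hZ : ∀ t, 0 < t → Commute Z (T t)) : Commute Z (laplaceResolvent T lam) := by
  rw [Commute, SemiconjBy, laplaceResolvent,
    ← integral_const_mul_of_integrable hint,
    ← integral_mul_const_of_integrable hint]
  refine MeasureTheory.setIntegral_congr_fun measurableSet_Ioi fun t ht => ?_
  exact ((hZ t ht).smul_right _).eq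

/-- The resolvent equation between the Laplace transform of `T` and an operator `W` that behaves
like `(mu + A)⁻¹`. -/
lemma laplaceResolvent_sub [CompleteSpace H] (hc : 0 < c) (hT0 : T 0 = 1)
    (hcont : ContinuousOn T (Set.Ioi 0))
    (hTK : ∀ t, 0 < t → ‖T t‖ ≤ K * Real.exp (-(c * t))) {lam mu : ℝ} (hlam : 0 ≤ lam)
    {W : H →L[ℂ] H}
    (hderiv : ∀ t, 0 < t → HasDerivAt (fun u => T u * W) (mu • (T t * W) - T t) t)
    (hzero : Tendsto (fun t => T t * W) (𝓝[>] 0) (𝓝 W)) :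
    laplaceResolvent T lam - W = (mu - lam) • (laplaceResolvent T lam * W) := by
  have hint := integrableOn_exp_smul_semigroup hc hcont hTK hlam
  have hintW : MeasureTheory.IntegrableOn
      (fun t => (mu - lam) • ((Real.exp (-(lam * t)) • T t) * W)) (Set.Ioi 0) :=
    (hint.mul_const W).smul (mu - lam)
  have h1 : ContinuousWithinAt (fun t => Real.exp (-(lam * t)) • (T t * W)) (Set.Ici 0) 0 := by
    rw [← continuousWithinAt_Ioi_iff_Ici]
    have hexp : Continuous fun t : ℝ => Real.exp (-(lam * t)) := by fun_prop
    refine hexp.continuousWithinAt.smul ?_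
    rw [ContinuousWithinAt, hT0, one_mul]
    exact hzero
  have h2 : ∀ t ∈ Set.Ioi (0 : ℝ), HasDerivAt (fun t => Real.exp (-(lam * t)) • (T t * W))
      ((mu - lam) • ((Real.exp (-(lam * t)) • T t) * W) - Real.exp (-(lam * t)) • T t) t := by
    intro t ht
    have h3 : HasDerivAt (fun t : ℝ => Real.exp (-(lam * t))) (Real.exp (-(lam * t)) * -lam) t := by
      simpa using ((hasDerivAt_id t).const_mul lam).neg.exp
    refine (h3.smul (hderiv t ht)).congr_deriv ?_
    rw [smul_mul_assoc]
    module
  have h4 : Tendsto (fun t => Real.exp (-(lam * t)) • (T t * W)) atTop (𝓝 0) := by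
    have h5 : Tendsto (fun t => K * Real.exp (-(c * t)) * ‖W‖) atTop (𝓝 0) := by
      have h6 : Tendsto (fun t : ℝ => Real.exp (-(c * t))) atTop (𝓝 0) :=
        Real.tendsto_exp_neg_atTop_nhds_zero.comp (tendsto_id.const_mul_atTop hc)
      simpa using (h6.const_mul K).mul_const ‖W‖
    refine squeeze_zero_norm' ?_ h5
    filter_upwards [eventually_gt_atTop 0] with t ht
    rw [norm_smul, Real.norm_eq_abs, Real.abs_exp]
    calc _ ≤ 1 * ‖T t * W‖ := by
          gcongr
          exact Real.exp_le_one_iff.2 (by nlinarith)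
      _ ≤ 1 * (‖T t‖ * ‖W‖) := by
          gcongr
          exact norm_mul_le _ _
      _ ≤ _ := by
          rw [one_mul]
          gcongr
          exact hTK t ht
  have h7 := MeasureTheory.integral_Ioi_of_hasDerivAt_of_tendsto h1 h2 (hintW.sub hint) h4
  rw [MeasureTheory.integral_sub hintW hint, MeasureTheory.integral_smul,
    integral_mul_const_of_integrable hint] at h7
  simp only [mul_zero, neg_zero, Real.exp_zero, one_smul, hT0, one_mul, zero_sub] at h7
  rw [laplaceResolvent]
  linear_combination (norm := module) (-1 : ℝ) • h7

end Generator

section Construction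

variable {T : ℝ → H →L[ℂ] H} {A : H →ₗ.[ℂ] H} {J : H →L[ℂ] H} {K c β : ℝ}

/-- The Crandall–Pazy bound extends from small times to all positive times. -/
lemma exists_norm_le_of_inCrandallPazy (hT : IsC0Semigroup T) (hgen : IsGenerator T A)
    (hJ : IsResolventAt A 0 J) (hβ : 0 < β) (hCP : InCrandallPazy T A β) (hK : 0 ≤ K)
    (hc : 0 < c) (hTK : ∀ t, 0 ≤ t → ‖T t‖ ≤ K * Real.exp (-(c * t))) :
    ∃ B : ℝ → H →L[ℂ] H, (∀ t, 0 < t → J * B t = T t) ∧ (∀ t, 0 < t → B t * J = T t) ∧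
      ∃ M : ℝ, 0 ≤ M ∧ ∀ t, 0 < t → ‖B t‖ ≤ M * t ^ (-(1 / β)) := by
  obtain ⟨B, hB, M, t₀, hM, ht₀, hBM⟩ := hCP
  have hJB : ∀ t, 0 < t → J * B t = T t := by
    intro t ht
    ext x
    obtain ⟨hx, e⟩ := hB t ht x
    have h1 := hJ.2 ⟨T t x, hx⟩
    rw [zero_smul, zero_add, ← e] at h1
    exact h1
  refine ⟨B, hJB, fun t ht => hJ.mul_left_cancel ?_,
    M + ‖B t₀‖ * K * Real.exp (c * t₀) * (1 / (c * β)) ^ (1 / β), by positivity, fun t ht => ?_⟩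
  · rw [← mul_assoc, hJB t ht, (hgen.commute_inverse hT hJ ht.le).eq]
  have hpow : 0 < t ^ (-(1 / β)) := Real.rpow_pos_of_pos ht _
  rw [add_mul]
  rcases le_total t t₀ with htt | htt
  · refine (hBM t ht htt).trans (le_add_of_nonneg_right ?_)
    positivity
  · refine le_trans ?_ (le_add_of_nonneg_left (by positivity))
    have h1 : B t = B t₀ * T (t - t₀) := by
      refine hJ.mul_left_cancel ?_
      rw [← mul_assoc, hJB t ht, hJB t₀ ht₀]
      have := hT.map_add t₀ (t - t₀) ht₀.le (by linarith)
      rw [add_sub_cancel] at this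
      exact this
    have h2 : Real.exp (-(c * t)) ≤ (1 / (c * β)) ^ (1 / β) * t ^ (-(1 / β)) := by
      have h3 : t ≤ 1 / (c * β) * Real.exp (c * β * t) := by
        have h4 := Real.add_one_le_exp (c * β * t)
        rw [one_div_mul_eq_div, le_div_iff₀ (by positivity)]
        linarith
      have h5 : t ^ (1 / β) ≤ (1 / (c * β)) ^ (1 / β) * Real.exp (c * t) := by
        calc t ^ (1 / β) ≤ (1 / (c * β) * Real.exp (c * β * t)) ^ (1 / β) := by gcongr
          _ = _ := by
            rw [Real.mul_rpow (by positivity) (Real.exp_pos _).le, ← Real.exp_mul]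
            congr 2
            field_simp
      rw [Real.rpow_neg ht.le, Real.exp_neg, ← div_eq_mul_inv,
        le_div_iff₀ (Real.rpow_pos_of_pos ht _), inv_mul_le_iff₀ (Real.exp_pos _)]
      linarith
    calc ‖B t‖ ≤ ‖B t₀‖ * ‖T (t - t₀)‖ := by
          rw [h1]
          exact norm_mul_le _ _
      _ ≤ ‖B t₀‖ * (K * Real.exp (-(c * (t - t₀)))) := by
          gcongr
          exact hTK _ (by linarith)
      _ = ‖B t₀‖ * K * Real.exp (c * t₀) * Real.exp (-(c * t)) := by
          rw [mul_assoc (‖B t₀‖ * K), ← Real.exp_add]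
          ring_nf
      _ ≤ ‖B t₀‖ * K * Real.exp (c * t₀) * ((1 / (c * β)) ^ (1 / β) * t ^ (-(1 / β))) := by
          gcongr
      _ = _ := by ring

/-- Any resolvent at `w ≥ 0` coincides with the operator satisfying the resolvent identity with
`J = A⁻¹`. -/
lemma IsResolventAt.eq_of_eq_inverse_mul (hJ : IsResolventAt A 0 J) {w : ℝ} {R R' : H →L[ℂ] H}
    (hR' : IsResolventAt A (w : ℂ) R') (hR : R = J * (1 - w • R)) (hcomm : Commute J R) :
    R' = R := by
  have h1 : R' = J * (1 - w • R') := by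
    ext x
    obtain ⟨hx, e⟩ := hR'.1 x
    have h2 := hJ.2 ⟨R' x, hx⟩
    rw [zero_smul, zero_add] at h2
    have h3 : A ⟨R' x, hx⟩ = x - w • R' x := by
      rw [← Complex.coe_smul, eq_sub_iff_add_eq, add_comm, e]
    rw [h3] at h2
    exact h2.symm
  have h4 : (1 - w • R) * J = R := by
    have : Commute J (1 - w • R) := (Commute.one_right J).sub_right (hcomm.smul_right w)
    rw [← this.eq, ← hR]
  have h5 : (1 - w • R) * R' = R * (1 - w • R') := by
    conv_lhs => rw [h1, ← mul_assoc, h4]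
  rw [sub_mul, mul_sub, one_mul, mul_one, smul_mul_assoc, mul_smul_comm] at h5
  exact sub_left_injective h5

theorem exists_isResolventFamily [CompleteSpace H] (hT : IsC0Semigroup T) (hgen : IsGenerator T A)
    (hstab : IsExpStable T) (hβ0 : 0 < β) (hβ1 : β ≤ 1) (hCP : InCrandallPazy T A β)
    (hJ : IsResolventAt A 0 J) :
    ∃ (R : ℝ → H →L[ℂ] H) (K c L : ℝ), IsResolventFamily T R K c L β ∧ R 0 = J ∧
      ∀ w : ℝ, 0 ≤ w → ∀ R', IsResolventAt A (w : ℂ) R' → R' = R w := by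
  obtain ⟨K, c₀, hK, hc₀, hTK₀⟩ := hstab
  obtain ⟨c, hc, hc1, hTK⟩ : ∃ c : ℝ, 0 < c ∧ c ≤ 1 ∧
      ∀ t, 0 ≤ t → ‖T t‖ ≤ K * Real.exp (-(c * t)) := by
    refine ⟨min c₀ 1, lt_min hc₀ one_pos, min_le_right _ _, fun t ht => (hTK₀ t ht).trans ?_⟩
    gcongr
    exact min_le_left _ _
  have hTK' : ∀ t, 0 < t → ‖T t‖ ≤ K * Real.exp (-(c * t)) := fun t ht => hTK t ht.le
  have hTbdd : ∀ t, 0 ≤ t → ‖T t‖ ≤ K := fun t ht =>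
    (hTK t ht).trans (mul_le_of_le_one_right hK.le (Real.exp_le_one_iff.2 (by nlinarith)))
  obtain ⟨B, hJB, hBJ, M, hM, hBM⟩ :=
    exists_norm_le_of_inCrandallPazy hT hgen hJ hβ0 hCP hK.le hc hTK
  have hcont := hgen.continuousOn_semigroup hT hJ hK.le hTbdd hJB
  have hderivJ : ∀ t, 0 < t → HasDerivAt (fun u => T u * J) (-T t) t := fun t ht =>
    hgen.hasDerivAt_mul_inverse hT hJ hcont ht
  have hzeroJ := hgen.tendsto_mul_inverse hT hJ hK.le hTbdd
  have hint : ∀ lam : ℝ, 0 ≤ lam → _ := fun lam hlam =>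
    integrableOn_exp_smul_semigroup hc hcont hTK' hlam
  have hTT : ∀ s t, 0 < s → 0 < t → Commute (T s) (T t) := by
    intro s t hs ht
    change T s ∘L T t = T t ∘L T s
    rw [← hT.map_add s t hs.le ht.le, ← hT.map_add t s ht.le hs.le, add_comm]
  set R := laplaceResolvent T with hR
  have hcommT : ∀ t lam, 0 < t → 0 ≤ lam → Commute (T t) (R lam) := fun t lam ht hlam =>
    commute_laplaceResolvent (hint lam hlam) fun s hs => hTT t s ht hs
  have hcommJ : ∀ lam, 0 ≤ lam → Commute J (R lam) := fun lam hlam =>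
    commute_laplaceResolvent (hint lam hlam) fun s hs =>
      (hgen.commute_inverse hT hJ hs.le).symm
  have hRJ : ∀ lam, 0 ≤ lam → R lam = J * (1 - lam • R lam) := by
    intro lam hlam
    have h1 := laplaceResolvent_sub (mu := 0) hc hT.map_zero hcont hTK' hlam
      (fun t ht => by simpa using hderivJ t ht) hzeroJ
    rw [← hR, ← (hcommJ lam hlam).eq] at h1
    rw [mul_sub, mul_one, mul_smul_comm]
    linear_combination (norm := module) (1 : ℝ) • h1
  have hderiv : ∀ lam t, 0 ≤ lam → 0 < t →
      HasDerivAt (fun u => T u * R lam) (lam • (T t * R lam) - T t) t := by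
    intro lam t hlam ht
    have h1 := (hderivJ t ht).mul_const (1 - lam • R lam)
    have h2 : (fun u => T u * J * (1 - lam • R lam)) = fun u => T u * R lam := by
      funext u
      rw [mul_assoc, ← hRJ lam hlam]
    rw [h2] at h1
    refine h1.congr_deriv ?_
    rw [mul_sub, mul_one, mul_smul_comm, neg_mul]
    module
  have hzero : ∀ lam, 0 ≤ lam → Tendsto (fun t => T t * R lam) (𝓝[>] 0) (𝓝 (R lam)) := by
    intro lam hlam
    have h1 := hzeroJ.mul_const (1 - lam • R lam)
    rw [← hRJ lam hlam] at h1
    refine h1.congr fun t => ?_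
    rw [mul_assoc, ← hRJ lam hlam]
  have hnormR : ∀ lam, 0 ≤ lam → ‖R lam‖ ≤ K / (c + lam) := fun lam hlam =>
    norm_laplaceResolvent_le hc hTK' hlam
  refine ⟨R, K, c, 2 * (K * (1 + K)) + 2 * (M * (K / c)), ?_, by simpa using hRJ 0 le_rfl,
    fun w hw R' hR' => hJ.eq_of_eq_inverse_mul hR' (hRJ w hw) (hcommJ w hw)⟩
  refine ⟨hK.le, hc, hc1, hcommT, ?_, ?_, hderiv, hzero, hTK', hnormR, ?_⟩
  · exact fun lam mu hlam hmu => commute_laplaceResolvent (hint mu hmu) fun s hs =>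
      (hcommT s lam hs hlam).symm
  · exact fun lam mu hlam hmu => laplaceResolvent_sub hc hT.map_zero hcont hTK' hlam
      (fun t ht => hderiv mu t hmu ht) (hzero mu hmu)
  · intro t lam ht hlam
    have hlam1 : 0 < lam + 1 := by linarith
    have hbdd : ‖T t * (1 - lam • R lam)‖ ≤ K * (1 + K) := by
      have h1 : ‖lam • R lam‖ ≤ K := by
        rw [norm_smul, Real.norm_eq_abs, abs_of_nonneg hlam]
        calc lam * ‖R lam‖ ≤ lam * (K / (c + lam)) := by
              gcongr
              exact hnormR lam hlam
          _ ≤ K := by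
              rw [mul_div_assoc', div_le_iff₀ (by linarith)]
              nlinarith
      calc _ ≤ ‖T t‖ * ‖1 - lam • R lam‖ := norm_mul_le _ _
        _ ≤ K * (1 + K) := by
          gcongr
          · exact hTbdd t ht.le
          · exact (norm_sub_le _ _).trans (add_le_add ContinuousLinearMap.norm_id_le h1)
    set r := (lam + 1) ^ β * t with hr
    have hr0 : 0 < r := mul_pos (Real.rpow_pos_of_pos hlam1 _) ht
    have hdecay : ‖T t * (1 - lam • R lam)‖ ≤ M * (K / c) * r ^ (-(1 / β)) := by
      have h1 : T t * (1 - lam • R lam) = B t * R lam := by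
        rw [← hBJ t ht, mul_assoc, ← hRJ lam hlam]
      have h2 : r ^ (-(1 / β)) = (lam + 1)⁻¹ * t ^ (-(1 / β)) := by
        rw [hr, Real.mul_rpow (by positivity) ht.le, ← Real.rpow_mul hlam1.le,
          show β * -(1 / β) = -1 by field_simp, Real.rpow_neg_one]
      have h3 : K / (c + lam) ≤ K / c * (lam + 1)⁻¹ := by
        rw [← div_eq_mul_inv, div_div]
        gcongr
        nlinarith
      have h4 : 0 ≤ t ^ (-(1 / β)) := by positivity
      rw [h1, h2]
      calc _ ≤ ‖B t‖ * ‖R lam‖ := norm_mul_le _ _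
        _ ≤ M * t ^ (-(1 / β)) * (K / c * (lam + 1)⁻¹) := by
          gcongr
          · exact hBM t ht
          · exact (hnormR lam hlam).trans h3
        _ = _ := by ring
    have hD : 0 ≤ M * (K / c) := by positivity
    have hKK : 0 ≤ K * (1 + K) := by positivity
    rw [le_div_iff₀ (by linarith)]
    rcases le_total r 1 with hr1 | hr1
    · nlinarith [norm_nonneg (T t * (1 - lam • R lam))]
    · have h1 : r ^ (-(1 / β)) ≤ r⁻¹ := by
        rw [← Real.rpow_neg_one]
        refine Real.rpow_le_rpow_of_exponent_le hr1 ?_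
        rw [neg_le_neg_iff, le_div_iff₀ hβ0]
        linarith
      have h2 : ‖T t * (1 - lam • R lam)‖ ≤ M * (K / c) * r⁻¹ := hdecay.trans (by gcongr)
      rw [← div_eq_mul_inv, le_div_iff₀ hr0] at h2
      nlinarith [norm_nonneg (T t * (1 - lam • R lam))]

end Construction

/-- Theorem 3.4: if `-A` generates an exponentially stable `C₀`-semigroup in the
Crandall–Pazy class with parameter `β ∈ (0,1]` on a Hilbert space, then for every positive
integer `α`, every `ε > 0` and every `0 < ω_min ≤ ω_max < ∞` there is `M > 0` such that
`‖(∏_{k=1}^n V_{ω_k}(A)) A^{-α}‖ ≤ M (log (n+1))^{2α/(2-β)+ε} n^{-α/(2-β)}`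
for all `n` and all `(ω_k) ∈ S(ω_min, ω_max)`.  The Cayley transform is expressed via
`V_ω(A) = 1 - 2ω (ω + A)⁻¹` and `A^{-α} = ((0 + A)⁻¹)^α`. -/
theorem cayley_product_decay_of_crandallPazy
    {H : Type*} [NormedAddCommGroup H] [InnerProductSpace ℂ H] [CompleteSpace H]
    (T : ℝ → H →L[ℂ] H) (A : H →ₗ.[ℂ] H)
    (hT : IsC0Semigroup T) (hgen : IsGenerator T A)
    (hstab : IsExpStable T)
    (β : ℝ) (hβ0 : 0 < β) (hβ1 : β ≤ 1) (hCP : InCrandallPazy T A β)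
    (Ainv : H →L[ℂ] H) (hAinv : IsResolventAt A 0 Ainv)
    (α : ℕ) (hα : 0 < α) (ε : ℝ) (hε : 0 < ε)
    (ωmin ωmax : ℝ) (hωmin : 0 < ωmin) (hω : ωmin ≤ ωmax) :
    ∃ M : ℝ, 0 < M ∧ ∀ n : ℕ, 1 ≤ n → ∀ ω : ℕ → ℝ,
      (∀ k, ωmin ≤ ω k ∧ ω k ≤ ωmax) →
      ∀ R : ℕ → H →L[ℂ] H, (∀ k, IsResolventAt A ((ω k : ℝ) : ℂ) (R k)) →
        ‖((List.range n).map fun k => (1 : H →L[ℂ] H) - ((2 * ω k : ℝ) : ℂ) • R k).prod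
            * Ainv ^ α‖ ≤
          M * Real.log ((n : ℝ) + 1) ^ (2 * (α : ℝ) / (2 - β) + ε) *
            (n : ℝ) ^ (-((α : ℝ) / (2 - β))) := by
  obtain ⟨R₀, K, c, L, hfam, hzero, huniq⟩ :=
    exists_isResolventFamily hT hgen hstab hβ0 hβ1 hCP hAinv
  obtain ⟨a, rfl⟩ := Nat.exists_eq_succ_of_ne_zero hα.ne'
  obtain ⟨C, hC, hbound⟩ :=
    hfam.norm_cayleyProd_mul_resolvent_zero_pow_le hβ0.le hβ1 ωmax hωmin a
  set p : ℝ := 2 * ((a.succ : ℕ) : ℝ) / (2 - β) + ε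
  have hlog2 : 0 < Real.log 2 := Real.log_pos (by norm_num)
  have hD : 0 < Real.log 2 ^ (((a.succ : ℕ) : ℝ) - p) := Real.rpow_pos_of_pos hlog2 _
  refine ⟨(C + 1) * Real.log 2 ^ (((a.succ : ℕ) : ℝ) - p), by positivity,
    fun n hn ω hωn R hR => ?_⟩
  have hprod : ((List.range n).map fun k =>
      (1 : H →L[ℂ] H) - ((2 * ω k : ℝ) : ℂ) • R k).prod = cayleyProd R₀ 0 ω n := by
    rw [cayleyProd]
    congr 2
    funext k
    rw [shiftedCayley, zero_add, Complex.coe_smul,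
      huniq (ω k) (hωmin.le.trans (hωn k).1) (R k) (hR k)]
  rw [hprod, ← hzero]
  have hn' : (1 : ℝ) ≤ n := by exact_mod_cast hn
  have hlog : Real.log 2 ≤ Real.log ((n : ℝ) + 1) :=
    Real.log_le_log (by norm_num) (by linarith)
  have hlog0 : 0 < Real.log ((n : ℝ) + 1) := hlog2.trans_le hlog
  have hαp : ((a.succ : ℕ) : ℝ) ≤ p := by
    have h1 : ((a.succ : ℕ) : ℝ) ≤ 2 * ((a.succ : ℕ) : ℝ) / (2 - β) := by
      rw [le_div_iff₀ (by linarith)]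
      nlinarith [Nat.cast_nonneg (α := ℝ) a.succ]
    linarith
  have hlogpow : Real.log ((n : ℝ) + 1) ^ (a + 1)
      ≤ Real.log 2 ^ (((a.succ : ℕ) : ℝ) - p) * Real.log ((n : ℝ) + 1) ^ p := by
    have h1 : Real.log ((n : ℝ) + 1) ^ (a + 1) =
        Real.log ((n : ℝ) + 1) ^ (((a.succ : ℕ) : ℝ) - p) * Real.log ((n : ℝ) + 1) ^ p := by
      rw [← Real.rpow_add hlog0, sub_add_cancel, Real.rpow_natCast]
    rw [h1]
    exact mul_le_mul_of_nonneg_right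
      (Real.rpow_le_rpow_of_nonpos hlog2 hlog (sub_nonpos.2 hαp))
      (Real.rpow_nonneg hlog0.le _)
  have hnpow : ((n : ℝ) ^ (-(1 / (2 - β)))) ^ (a + 1)
      = (n : ℝ) ^ (-(((a.succ : ℕ) : ℝ) / (2 - β))) := by
    rw [← Real.rpow_natCast, ← Real.rpow_mul (by linarith)]
    congr 1
    push_cast
    ring
  calc _ ≤ C * (Real.log ((n : ℝ) + 1) ^ (a + 1) * ((n : ℝ) ^ (-(1 / (2 - β)))) ^ (a + 1)) := by
        rw [← mul_pow]
        exact hbound n hn ω hωn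
    _ ≤ (C + 1) * (Real.log 2 ^ (((a.succ : ℕ) : ℝ) - p) * Real.log ((n : ℝ) + 1) ^ p *
          (n : ℝ) ^ (-(((a.succ : ℕ) : ℝ) / (2 - β)))) := by
        rw [hnpow]
        gcongr
        linarith
    _ = _ := by ring

end
end
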